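/- arXiv:1710.03847 — 2 statements merged into one kernel-verified Lean document; each statement's English description precedes it below -/
import Mathlib

section
/- Let F be a k-edge-colored hypergraph in which every edge is incident with exactly three hinges, and let g : V(F) → ℕ₊ be such that for each vertex x, g(x) ≤ 2 implies m_F(x³) = 0 and g(x) = 1 implies m_F(x², y) = 0 for every vertex y. Then there exists a 3-uniform g-detachment G of F with amalgamation function Ψ : V(G) → V(F) (so |Ψ⁻¹(x)| = g(x) for each x ∈ V(F)) satisfying: (A1) d_G(u) ≈ d_F(x)/g(x) for each x ∈ V(F) and each u ∈ Ψ⁻¹(x); (A2) d_{G(j)}(u) ≈ d_{F(j)}(x)/g(x) for each x ∈ V(F), each u ∈ Ψ⁻¹(x) and each color j ∈ {1,…,k}; (A3) m_G(u, v, w) ≈ m_F(x, y, z)/g̃(x, y, z) for all x, y, z ∈ V(F) (with g(x) ≥ 3 if x = y = z, and g(x) ≥ 2 if exactly two of x, y, z coincide with common value x) and every triple of distinct vertices u ∈ Ψ⁻¹(x), v ∈ Ψ⁻¹(y), w ∈ Ψ⁻¹(z); (A4) m_{G(j)}(u, v, w) ≈ m_{F(j)}(x, y, z)/g̃(x, y,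 z) for all such x, y, z, u, v, w and each color j ∈ {1,…,k}. -/
/-- The multiset of vertices (with repetition) incident with the edge `e`,
in the hypergraph given by the hinge-to-vertex map `ψ` and the
hinge-to-edge map `φ`. -/
def edgeVerts {V E H : Type} [Fintype H] [DecidableEq E]
    (ψ : H → V) (φ : H → E) (e : E) : Multiset V :=
  (Finset.univ.filter fun h => φ h = e).val.map ψ

/-- `mF ψ φ x y z` is the number of edges incident with exactly three hinges
whose multiset of incident vertices is `{x, y, z}`. -/
def mF {V E H : Type} [Fintype E] [Fintype H] [DecidableEq V] [DecidableEq E]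
    (ψ : H → V) (φ : H → E) (x y z : V) : ℕ :=
  (Finset.univ.filter fun e => edgeVerts ψ φ e = ({x, y, z} : Multiset V)).card

/-- Colored version of `mF`: only edges of color `j` are counted. -/
def mFc {V E H : Type} {k : ℕ} [Fintype E] [Fintype H] [DecidableEq V] [DecidableEq E]
    (ψ : H → V) (φ : H → E) (K : E → Fin k) (j : Fin k) (x y z : V) : ℕ :=
  (Finset.univ.filter fun e => K e = j ∧ edgeVerts ψ φ e = ({x, y, z} : Multiset V)).card

/-- The degree of a vertex: the number of hinges incident with it. -/
def degF {V H : Type} [Fintype H] [DecidableEq V] (ψ : H → V) (v : V) : ℕ :=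
  (Finset.univ.filter fun h => ψ h = v).card

/-- The degree of a vertex in the color class `j`. -/
def degFc {V E H : Type} {k : ℕ} [Fintype H] [DecidableEq V]
    (ψ : H → V) (φ : H → E) (K : E → Fin k) (j : Fin k) (v : V) : ℕ :=
  (Finset.univ.filter fun h => ψ h = v ∧ K (φ h) = j).card

/-- `approx a y` means `⌊y⌋ ≤ a ≤ ⌈y⌉`. -/
def approx (a : ℕ) (y : ℚ) : Prop := ⌊y⌋ ≤ (a : ℤ) ∧ (a : ℤ) ≤ ⌈y⌉

/-- The symmetric function `g̃`: `g̃(x,x,x) = C(g x, 3)`,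
`g̃(x,x,y) = C(g x, 2) * g y` for `y ≠ x`, and
`g̃(x,y,z) = g x * g y * g z` for distinct `x, y, z`. -/
def gtilde {V : Type} [DecidableEq V] (g : V → ℕ) (x y z : V) : ℕ :=
  if x = y ∧ y = z then Nat.choose (g x) 3
  else if x = y then Nat.choose (g x) 2 * g z
  else if x = z then Nat.choose (g x) 2 * g y
  else if y = z then Nat.choose (g y) 2 * g x
  else g x * g y * g z

/-- A nonzero circulation supported on `S`, if no vertex meets exactly one end of an arc of `S`. -/
theorem exists_circulation_of_two_le {N A : Type} [DecidableEq N] [DecidableEq A]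
    (s t : A → N) (S : Finset A) (hS : S.Nonempty)
    (h2 : ∀ v ∈ S.image s ∪ S.image t,
      2 ≤ (S.filter fun a => s a = v).card + (S.filter fun a => t a = v).card) :
    ∃ d : A → ℚ, (∃ a ∈ S, d a ≠ 0) ∧ (∀ a ∉ S, d a = 0) ∧
      ∀ v, ∑ a ∈ S with s a = v, d a = ∑ a ∈ S with t a = v, d a := by
  set N' := S.image s ∪ S.image t with hN'
  have hs : ∀ a ∈ S, s a ∈ N' := fun a ha =>
    Finset.mem_union_left _ (Finset.mem_image_of_mem _ ha)
  have ht : ∀ a ∈ S, t a ∈ N' := fun a ha =>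
    Finset.mem_union_right _ (Finset.mem_image_of_mem _ ha)
  obtain ⟨a₀, ha₀⟩ := hS
  have hcard : N'.card ≤ S.card := by
    have h := Finset.sum_le_sum h2
    rw [Finset.sum_add_distrib, ← Finset.card_eq_sum_card_fiberwise hs,
      ← Finset.card_eq_sum_card_fiberwise ht, Finset.sum_const, smul_eq_mul] at h
    omega
  let T : (S → ℚ) →ₗ[ℚ] (N'.erase (s a₀) → ℚ) :=
    { toFun := fun d v => ∑ a : S, ((if s a = v then d a else 0) - if t a = v then d a else 0)
      map_add' := fun d d' => by
        ext v
        simp only [Pi.add_apply, ← Finset.sum_add_distrib]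
        refine Finset.sum_congr rfl fun a _ => ?_
        split_ifs <;> ring
      map_smul' := fun r d => by
        ext v
        simp only [Pi.smul_apply, smul_eq_mul, RingHom.id_apply, Finset.mul_sum]
        refine Finset.sum_congr rfl fun a _ => ?_
        split_ifs <;> ring }
  have hlt : Module.finrank ℚ (N'.erase (s a₀) → ℚ) < Module.finrank ℚ (S → ℚ) := by
    have := Finset.card_erase_lt_of_mem (hs a₀ ha₀)
    simp only [Module.finrank_fintype_fun_eq_card, Fintype.card_coe]
    omega
  obtain ⟨d, hd, hd0⟩ :=
    (Submodule.ne_bot_iff _).1 (LinearMap.ker_ne_bot_of_finrank_lt (f := T) hlt)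
  have hT : ∀ v ∈ N'.erase (s a₀),
      ∑ a : S, ((if s a = v then d a else 0) - if t a = v then d a else 0) = 0 := fun v hv =>
    congrFun (LinearMap.mem_ker.1 hd) ⟨v, hv⟩
  set d' : A → ℚ := fun a => if h : a ∈ S then d ⟨a, h⟩ else 0 with hd'
  have hd'S : ∀ a : S, d' a = d a := fun a => by simp [hd']
  have key : ∀ v, ∑ a : S, ((if s a = v then d a else 0) - if t a = v then d a else 0) =
      ∑ a ∈ S with s a = v, d' a - ∑ a ∈ S with t a = v, d' a := by
    intro v
    rw [Finset.sum_filter, Finset.sum_filter, ← Finset.sum_sub_distrib,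
      ← Finset.sum_coe_sort S]
    simp only [hd'S]
  refine ⟨d', ?_, fun a ha => by simp [hd', ha], ?_⟩
  · by_contra! hcon
    exact hd0 (funext fun a => by rw [← hd'S]; exact hcon a a.2)
  · have hne : ∀ v, v ≠ s a₀ →
        ∑ a ∈ S with s a = v, d' a - ∑ a ∈ S with t a = v, d' a = 0 := by
      intro v hv
      by_cases hvN : v ∈ N'
      · rw [← key, hT v (Finset.mem_erase.2 ⟨hv, hvN⟩)]
      · rw [Finset.filter_false_of_mem, Finset.filter_false_of_mem]
        · simp
        · rintro a ha rfl
          exact hvN (ht a ha)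
        · rintro a ha rfl
          exact hvN (hs a ha)
    have htot : ∑ v ∈ N', (∑ a ∈ S with s a = v, d' a - ∑ a ∈ S with t a = v, d' a) = 0 := by
      rw [Finset.sum_sub_distrib, Finset.sum_fiberwise_of_maps_to hs,
        Finset.sum_fiberwise_of_maps_to ht, sub_self]
    rw [Finset.sum_eq_single_of_mem _ (hs a₀ ha₀) fun v _ hv => hne v hv] at htot
    intro v
    rw [← sub_eq_zero]
    by_cases hv : v = s a₀
    · rw [hv, htot]
    · exact hne v hv

open Classical in
/-- If a sum of rationals over `P` equals one over `Q`, then these sums do not contain exactly one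
non-integral term. -/
theorem card_filter_add_card_filter_ne_one {A : Type} (f : A → ℚ) (P Q : Finset A)
    (h : ∑ a ∈ P, f a = ∑ a ∈ Q, f a) :
    (P.filter fun a => f a ∉ (Int.castRingHom ℚ).range).card +
      (Q.filter fun a => f a ∉ (Int.castRingHom ℚ).range).card ≠ 1 := by
  have aux : ∀ P Q : Finset A, ∑ a ∈ P, f a = ∑ a ∈ Q, f a →
      (P.filter fun a => f a ∉ (Int.castRingHom ℚ).range).card = 1 →
      (Q.filter fun a => f a ∉ (Int.castRingHom ℚ).range).card ≠ 0 := by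
    intro P Q h h1 h0
    obtain ⟨a₀, ha₀⟩ := Finset.card_eq_one.1 h1
    have hmem : a₀ ∈ P.filter fun a => f a ∉ (Int.castRingHom ℚ).range :=
      ha₀ ▸ Finset.mem_singleton_self a₀
    rw [Finset.mem_filter] at hmem
    refine hmem.2 ?_
    have hsum := Finset.add_sum_erase P f hmem.1
    rw [eq_sub_of_add_eq hsum, h]
    refine sub_mem (sum_mem fun a ha => ?_) (sum_mem fun a ha => ?_)
    · by_contra hcon
      exact Finset.notMem_empty a
        (Finset.card_eq_zero.1 h0 ▸ Finset.mem_filter.2 ⟨ha, hcon⟩)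
    · by_contra hcon
      have := ha₀ ▸ Finset.mem_filter.2 ⟨Finset.mem_of_mem_erase ha, hcon⟩
      exact Finset.ne_of_mem_erase ha (Finset.mem_singleton.1 this)
  intro h1
  have := aux P Q h
  have := aux Q P h.symm
  omega

/-- A point can be moved along a line within its integer cell until some coordinate in which the
direction does not vanish becomes integral. -/
theorem exists_move_to_integral {A : Type} (f d : A → ℚ) (S : Finset A)
    (hd : ∃ a ∈ S, d a ≠ 0) (hd0 : ∀ a ∉ S, d a = 0) :
    ∃ r : ℚ, (∀ a, ⌊f a⌋ ≤ f a + r * d a ∧ f a + r * d a ≤ ⌈f a⌉) ∧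
      ∃ a ∈ S, f a + r * d a ∈ (Int.castRingHom ℚ).range := by
  classical
  let b : A → ℚ := fun a => if 0 < d a then ⌈f a⌉ else ⌊f a⌋
  have hne : (S.filter fun a => d a ≠ 0).Nonempty := by
    obtain ⟨a, ha, h⟩ := hd
    exact ⟨a, Finset.mem_filter.2 ⟨ha, h⟩⟩
  obtain ⟨a₀, ha₀, hmin⟩ := Finset.exists_min_image _ (fun a => (b a - f a) / d a) hne
  rw [Finset.mem_filter] at ha₀
  set r := (b a₀ - f a₀) / d a₀ with hr
  have hr0 : 0 ≤ r := by
    rw [hr]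
    by_cases h : 0 < d a₀
    · simp only [b, if_pos h]
      exact div_nonneg (sub_nonneg.2 (Int.le_ceil _)) h.le
    · simp only [b, if_neg h]
      exact div_nonneg_of_nonpos (sub_nonpos.2 (Int.floor_le _)) (not_lt.1 h)
  refine ⟨r, fun a => ?_, a₀, ha₀.1, ?_⟩
  · have h1 := Int.floor_le (f a)
    have h2 := Int.le_ceil (f a)
    by_cases hda : d a = 0
    · simp [hda, h1, h2]
    have haS : a ∈ S := by
      by_contra h
      exact hda (hd0 a h)
    have hle := hmin a (Finset.mem_filter.2 ⟨haS, hda⟩)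
    rcases lt_or_gt_of_ne hda with hneg | hpos
    · simp only [b, if_neg hneg.not_gt] at hle
      rw [le_div_iff_of_neg hneg] at hle
      constructor
      · linarith
      · nlinarith
    · simp only [b, if_pos hpos] at hle
      rw [le_div_iff₀ hpos] at hle
      constructor
      · nlinarith
      · linarith
  · have : f a₀ + r * d a₀ = b a₀ := by
      rw [hr, div_mul_cancel₀ _ ha₀.2]
      ring
    rw [this]
    simp only [b]
    split_ifs
    · exact ⟨⌈f a₀⌉, rfl⟩
    · exact ⟨⌊f a₀⌋, rfl⟩

/-- Every rational circulation can be rounded to an integral one. -/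
theorem exists_integral_circulation {N A : Type} [Fintype A] [DecidableEq N]
    (s t : A → N) (f : A → ℚ)
    (hf : ∀ v, ∑ a with s a = v, f a = ∑ a with t a = v, f a) :
    ∃ f' : A → ℤ, (∀ v, ∑ a with s a = v, f' a = ∑ a with t a = v, f' a) ∧
      ∀ a, ⌊f a⌋ ≤ f' a ∧ f' a ≤ ⌈f a⌉ := by
  classical
  induction hn : (Finset.univ.filter fun a => f a ∉ (Int.castRingHom ℚ).range).card
    using Nat.strong_induction_on generalizing f with
  | _ n ih =>
  set S := Finset.univ.filter fun a => f a ∉ (Int.castRingHom ℚ).range with hSdef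
  have hS : ∀ a, a ∈ S ↔ f a ∉ (Int.castRingHom ℚ).range := fun a => by simp [hSdef]
  rcases S.eq_empty_or_nonempty with hemp | hne
  · have hint : ∀ a, ∃ z : ℤ, (z : ℚ) = f a := by
      intro a
      by_contra hcon
      exact Finset.notMem_empty a (hemp ▸ (hS a).2 fun ⟨z, hz⟩ => hcon ⟨z, hz⟩)
    choose f' hf' using hint
    refine ⟨f', fun v => ?_, fun a => by simp [← hf']⟩
    have := hf v
    simp only [← hf'] at this
    exact_mod_cast this
  · have h2 : ∀ v ∈ S.image s ∪ S.image t,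
        2 ≤ (S.filter fun a => s a = v).card + (S.filter fun a => t a = v).card := by
      intro v hv
      have h1 := card_filter_add_card_filter_ne_one f _ _ (hf v)
      rw [Finset.filter_comm (s · = v), ← hSdef, Finset.filter_comm (t · = v), ← hSdef] at h1
      have : 0 < (S.filter fun a => s a = v).card + (S.filter fun a => t a = v).card := by
        rcases Finset.mem_union.1 hv with h | h <;> obtain ⟨a, ha, rfl⟩ := Finset.mem_image.1 h
        · exact Nat.add_pos_left (Finset.card_pos.2 ⟨a, by simp [ha]⟩) _
        · exact Nat.add_pos_right _ (Finset.card_pos.2 ⟨a, by simp [ha]⟩)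
      omega
    obtain ⟨d, hd, hd0, hcirc⟩ := exists_circulation_of_two_le s t S hne h2
    obtain ⟨r, hr, a₁, ha₁, hint⟩ :=
      exists_move_to_integral f d S hd hd0
    have hsub : ∀ (p : A → Prop) [DecidablePred p], ∑ a with p a, d a = ∑ a ∈ S with p a, d a := by
      intro p _
      refine (Finset.sum_subset (Finset.filter_subset_filter _ (Finset.subset_univ _)) ?_).symm
      intro a ha ha'
      refine hd0 a fun haS => ha' (Finset.mem_filter.2 ⟨haS, (Finset.mem_filter.1 ha).2⟩)
    have hlt : (Finset.univ.filter fun a =>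
        f a + r * d a ∉ (Int.castRingHom ℚ).range).card < n := by
      rw [← hn]
      refine Finset.card_lt_card (Finset.ssubset_iff_of_subset ?_ |>.2
        ⟨a₁, ha₁, by simpa using hint⟩)
      intro a ha
      by_contra haS
      rw [Finset.mem_filter, hd0 a haS, mul_zero, add_zero] at ha
      exact haS ((hS a).2 ha.2)
    obtain ⟨f', hf', hb⟩ := ih _ hlt (fun a => f a + r * d a) (fun v => by
      rw [Finset.sum_add_distrib, Finset.sum_add_distrib, ← Finset.mul_sum, ← Finset.mul_sum,
        hf v, hsub (s · = v), hsub (t · = v), hcirc v]) rfl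
    exact ⟨f', hf', fun a => ⟨(Int.le_floor.2 (hr a).1).trans (hb a).1,
      (hb a).2.trans (Int.ceil_le.2 (hr a).2)⟩⟩

/-- `a` is an `n`-th of `p`, up to rounding. -/
def IsShare (n p a : ℕ) : Prop := ∀ q : ℕ, (q * n ≤ p → q ≤ a) ∧ (p ≤ q * n → a ≤ q)

theorem isShare_of_floor_ceil {n p a : ℕ} (hn : 0 < n) (z : ℤ) (hz : z = a)
    (h : ⌊(p : ℚ) / n⌋ ≤ z ∧ z ≤ ⌈(p : ℚ) / n⌉) : IsShare n p a := by
  have hn' : (0 : ℚ) < n := by exact_mod_cast hn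
  subst hz
  intro q
  constructor
  · intro hq
    have : (q : ℤ) ≤ ⌊(p : ℚ) / n⌋ := by
      rw [Int.le_floor, le_div_iff₀ hn']
      exact_mod_cast hq
    exact_mod_cast this.trans h.1
  · intro hq
    have : ⌈(p : ℚ) / n⌉ ≤ (q : ℤ) := by
      rw [Int.ceil_le, div_le_iff₀ hn']
      exact_mod_cast hq
    exact_mod_cast h.2.trans this

theorem sum_filter_sum_filter {X I I' M : Type} [Fintype X] [Fintype I] [DecidableEq I]
    [DecidableEq I'] [AddCommMonoid M] (w : X → M) (p : X → I) (q : I → I') (j : I') :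
    ∑ i with q i = j, ∑ x with p x = i, w x = ∑ x with q (p x) = j, w x := by
  rw [← Finset.sum_fiberwise_of_maps_to (s := Finset.univ.filter fun x => q (p x) = j)
    (t := Finset.univ.filter fun i => q i = j) (g := p) (by simp)]
  refine Finset.sum_congr rfl fun i hi => Finset.sum_congr ?_ fun _ _ => rfl
  ext x
  simp only [Finset.mem_filter, Finset.mem_univ, true_and] at hi ⊢
  constructor
  · rintro rfl
    exact ⟨hi, rfl⟩
  · exact fun h => h.2

/-- A finite set `D` has a subset that contains an `n`-th, up to rounding, of `D`, of each class of
a partition of `D`, and of each class of three successively coarser other partitions of `D`. -/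
theorem exists_isShare_subset {X J E U T : Type} [Fintype X] [Fintype J] [Fintype E] [Fintype U]
    [Fintype T] [DecidableEq J] [DecidableEq E] [DecidableEq U] [DecidableEq T]
    (D : Finset X) (c : X → J) (e : X → E) (u : E → U) (t : U → T) (n : ℕ) (hn : 0 < n) :
    ∃ B ⊆ D, IsShare n D.card B.card ∧
      (∀ i, IsShare n (D.filter fun x => c x = i).card (B.filter fun x => c x = i).card) ∧
      (∀ i, IsShare n (D.filter fun x => e x = i).card (B.filter fun x => e x = i).card) ∧
      (∀ i, IsShare n (D.filter fun x => u (e x) = i).card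
        (B.filter fun x => u (e x) = i).card) ∧
      ∀ i, IsShare n (D.filter fun x => t (u (e x)) = i).card
        (B.filter fun x => t (u (e x)) = i).card := by
  classical
  let src : X ⊕ J ⊕ E ⊕ U ⊕ T ⊕ Unit → J ⊕ E ⊕ U ⊕ T ⊕ Unit ⊕ Unit :=
    Sum.elim (fun x => .inl (c x)) <| Sum.elim (fun _ => .inr (.inr (.inr (.inr (.inl ()))))) <|
    Sum.elim (fun i => .inr (.inl i)) <| Sum.elim (fun i => .inr (.inr (.inl i))) <|
    Sum.elim (fun i => .inr (.inr (.inr (.inl i)))) fun _ => .inr (.inr (.inr (.inr (.inr ()))))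
  let tgt : X ⊕ J ⊕ E ⊕ U ⊕ T ⊕ Unit → J ⊕ E ⊕ U ⊕ T ⊕ Unit ⊕ Unit :=
    Sum.elim (fun x => .inr (.inl (e x))) <| Sum.elim (fun i => .inl i) <|
    Sum.elim (fun i => .inr (.inr (.inl (u i)))) <|
    Sum.elim (fun i => .inr (.inr (.inr (.inl (t i))))) <|
    Sum.elim (fun _ => .inr (.inr (.inr (.inr (.inr ())))))
      fun _ => .inr (.inr (.inr (.inr (.inl ()))))
  let w : X → ℚ := fun x => if x ∈ D then 1 / n else 0
  let f : X ⊕ J ⊕ E ⊕ U ⊕ T ⊕ Unit → ℚ :=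
    Sum.elim w <| Sum.elim (fun i => ∑ x with c x = i, w x) <|
    Sum.elim (fun i => ∑ x with e x = i, w x) <|
    Sum.elim (fun i => ∑ x with u (e x) = i, w x) <|
    Sum.elim (fun i => ∑ x with t (u (e x)) = i, w x) fun _ => ∑ x, w x
  obtain ⟨f', hf', hb⟩ := exists_integral_circulation src tgt f (by
    rintro (i | i | i | i | i | i)
    · simp [src, tgt, f, Finset.sum_filter, Fintype.sum_sum_type]
    · simp [src, tgt, f, Finset.sum_filter, Fintype.sum_sum_type]
    · have := sum_filter_sum_filter w e u i
      simp [src, tgt, f, Finset.sum_filter, Fintype.sum_sum_type] at this ⊢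
      exact this.symm
    · have := sum_filter_sum_filter w (fun x => u (e x)) t i
      simp [src, tgt, f, Finset.sum_filter, Fintype.sum_sum_type] at this ⊢
      exact this.symm
    · have := sum_filter_sum_filter w c (fun _ => ()) ()
      simp [src, tgt, f, Finset.sum_filter, Fintype.sum_sum_type] at this ⊢
      exact this
    · have := sum_filter_sum_filter w (fun x => t (u (e x))) (fun _ => ()) ()
      simp [src, tgt, f, Finset.sum_filter, Fintype.sum_sum_type] at this ⊢
      exact this.symm)
  let z : X → ℤ := fun x => f' (.inl x)
  have hJ : ∀ i, f' (.inr (.inl i)) = ∑ x with c x = i, z x := by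
    intro i
    have := hf' (.inl i)
    simp [src, tgt, Finset.sum_filter, Fintype.sum_sum_type] at this
    rw [← this, Finset.sum_filter]
  have hE : ∀ i, f' (.inr (.inr (.inl i))) = ∑ x with e x = i, z x := by
    intro i
    have := hf' (.inr (.inl i))
    simp [src, tgt, Finset.sum_filter, Fintype.sum_sum_type] at this
    rw [this, Finset.sum_filter]
  have hU : ∀ i, f' (.inr (.inr (.inr (.inl i)))) = ∑ x with u (e x) = i, z x := by
    intro i
    have := hf' (.inr (.inr (.inl i)))
    rw [← sum_filter_sum_filter z e u i]
    simp [src, tgt, Finset.sum_filter, Fintype.sum_sum_type, hE] at this ⊢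
    exact this
  have hT : ∀ i, f' (.inr (.inr (.inr (.inr (.inl i))))) =
      ∑ x with t (u (e x)) = i, z x := by
    intro i
    have := hf' (.inr (.inr (.inr (.inl i))))
    rw [← sum_filter_sum_filter z (fun x => u (e x)) t i]
    simp [src, tgt, Finset.sum_filter, Fintype.sum_sum_type, hU] at this ⊢
    exact this
  have hR : f' (.inr (.inr (.inr (.inr (.inr ()))))) = ∑ x, z x := by
    have := hf' (.inr (.inr (.inr (.inr (.inl ())))))
    have h2 := sum_filter_sum_filter z c (fun _ => ()) ()
    simp [src, tgt, Finset.sum_filter, Fintype.sum_sum_type, hJ] at this h2 ⊢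
    rw [← this, h2]
  have hn' : (1 : ℚ) ≤ n := by exact_mod_cast hn
  have hz : ∀ x, z x = if x ∈ D ∧ z x = 1 then 1 else 0 := by
    intro x
    have h := hb (.inl x)
    change ⌊w x⌋ ≤ z x ∧ z x ≤ ⌈w x⌉ at h
    by_cases hx : x ∈ D
    · simp only [w, if_pos hx] at h
      have h0 : 0 ≤ z x := (Int.floor_nonneg.2 (by positivity)).trans h.1
      have h1 : z x ≤ 1 := h.2.trans (Int.ceil_le.2 (by
        rw [Int.cast_one]
        exact div_le_one_of_le₀ hn' (by positivity)))
      simp only [hx, true_and]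
      split_ifs <;> omega
    · simp only [w, if_neg hx, Int.floor_zero, Int.ceil_zero] at h
      simp only [hx, false_and, if_false]
      omega
  have key : ∀ (p : X → Prop) [DecidablePred p] (y : ℤ), y = ∑ x with p x, z x →
      ⌊∑ x with p x, w x⌋ ≤ y ∧ y ≤ ⌈∑ x with p x, w x⌉ →
      IsShare n (D.filter p).card ((D.filter fun x => z x = 1).filter p).card := by
    intro p _ y hy h
    refine isShare_of_floor_ceil hn y ?_ ?_
    · rw [hy, Finset.sum_congr rfl fun x _ => hz x, Finset.sum_boole]
      congr 2
      ext x
      simp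
      tauto
    · convert h using 3 <;>
      · simp only [w]
        rw [Finset.sum_ite, Finset.sum_const, Finset.sum_const_zero, add_zero, nsmul_eq_mul,
          mul_one_div]
        congr 3
        ext x
        simp
        tauto
  refine ⟨D.filter fun x => z x = 1, Finset.filter_subset _ _, ?_,
    fun i => key _ _ (hJ i) (hb (.inr (.inl i))),
    fun i => key _ _ (hE i) (hb (.inr (.inr (.inl i)))),
    fun i => key _ _ (hU i) (hb (.inr (.inr (.inr (.inl i))))),
    fun i => key _ _ (hT i) (hb (.inr (.inr (.inr (.inr (.inl i))))))⟩
  have := key (fun _ => True) _ (by simpa using hR) (by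
    simpa [f] using hb (.inr (.inr (.inr (.inr (.inr ()))))))
  simpa using this

/-- The number of hinges at `v` of edges in `Q`. -/
def degOn {V E H : Type} [Fintype H] [DecidableEq V] [DecidableEq E]
    (ψ : H → V) (φ : H → E) (Q : Finset E) (v : V) : ℕ :=
  (Finset.univ.filter fun h => ψ h = v ∧ φ h ∈ Q).card

/-- The number of edges in `Q` whose multiset of incident vertices is `M`. -/
def multOn {V E H : Type} [Fintype H] [DecidableEq V] [DecidableEq E]
    (ψ : H → V) (φ : H → E) (Q : Finset E) (M : Multiset V) : ℕ :=
  (Q.filter fun e => edgeVerts ψ φ e = M).card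

/-- The number of submultisets isomorphic to `M` after each vertex `x` is replaced with `g x`
vertices, without repetition. -/
def weight {V : Type} [DecidableEq V] (g : V → ℕ) (M : Multiset V) : ℕ :=
  ∏ x ∈ M.toFinset, (g x).choose (M.count x)

/-- Integral bounds on the ratio `m / G` are also bounds on the ratio `m' / G'`. -/
def BoundsTransfer (m G m' G' : ℕ) : Prop :=
  ∀ q : ℕ, (q * G ≤ m → q * G' ≤ m') ∧ (m ≤ q * G → m' ≤ q * G')

/-- `Q` consists of all edges or of all edges of some color. -/
def IsColorClass {E C : Type} [Fintype E] [DecidableEq C] (K : E → C) (Q : Finset E) : Prop :=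
  Q = Finset.univ ∨ ∃ j, Q = Finset.univ.filter fun e => K e = j

theorem BoundsTransfer.refl (m G : ℕ) : BoundsTransfer m G m G := fun _ => ⟨id, id⟩

theorem BoundsTransfer.trans {m₁ G₁ m₂ G₂ m₃ G₃ : ℕ} (h : BoundsTransfer m₁ G₁ m₂ G₂)
    (h' : BoundsTransfer m₂ G₂ m₃ G₃) : BoundsTransfer m₁ G₁ m₃ G₃ :=
  fun q => ⟨fun hq => (h' q).1 ((h q).1 hq), fun hq => (h' q).2 ((h q).2 hq)⟩

theorem boundsTransfer_zero (m G : ℕ) : BoundsTransfer m G 0 0 := fun q => by simp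

theorem BoundsTransfer.eq_zero {m G m' G' : ℕ} (h : BoundsTransfer m G m' G') (hG : 0 < G)
    (hG' : G' = 0) : m' = 0 := by
  have := (h m).2 (Nat.le_mul_of_pos_right m hG)
  simpa [hG'] using this

theorem BoundsTransfer.approx_div {m G a : ℕ} (h : BoundsTransfer m G a 1) (hG : 0 < G) :
    approx a ((m : ℚ) / (G : ℚ)) := by
  have hG' : (0 : ℚ) < G := by exact_mod_cast hG
  have h0 : (0 : ℚ) ≤ (m : ℚ) / G := by positivity
  constructor
  · have := (h ⌊(m : ℚ) / G⌋₊).1 (by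
      have := Nat.floor_le h0
      rw [le_div_iff₀ hG'] at this
      exact_mod_cast this)
    rw [← Int.natCast_floor_eq_floor h0]
    exact_mod_cast (mul_one _).symm.le.trans this
  · have := (h ⌈(m : ℚ) / G⌉₊).2 (by
      have := Nat.le_ceil ((m : ℚ) / G)
      rw [div_le_iff₀ hG'] at this
      exact_mod_cast this)
    rw [← Int.natCast_ceil_eq_ceil h0]
    exact_mod_cast this.trans (mul_one _).le

theorem IsShare.boundsTransfer {n P m a G G' : ℕ} (h : IsShare n (P * m) a)
    (hG : n * G' = P * G) : BoundsTransfer m G a G' := by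
  intro q
  constructor
  · intro hq
    refine (h (q * G')).1 ?_
    calc q * G' * n = q * (n * G') := by ring
      _ = P * (q * G) := by rw [hG]; ring
      _ ≤ P * m := Nat.mul_le_mul_left _ hq
  · intro hq
    refine (h (q * G')).2 ?_
    calc P * m ≤ P * (q * G) := Nat.mul_le_mul_left _ hq
      _ = q * (n * G') := by rw [hG]; ring
      _ = q * G' * n := by ring

theorem IsShare.boundsTransfer_sub {n P m a G G' : ℕ} (h : IsShare n (P * m) a) (hn : 0 < n)
    (hP : P ≤ n) (hG : n * G' = (n - P) * G) : BoundsTransfer m G (m - a) G' := by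
  obtain ⟨r, rfl⟩ := Nat.exists_eq_add_of_le hP
  rw [Nat.add_sub_cancel_left] at hG
  intro q
  constructor
  · intro hq
    have hle : q * G' ≤ m := by
      refine Nat.le_of_mul_le_mul_left ?_ hn
      calc (P + r) * (q * G') = q * ((P + r) * G') := by ring
        _ = r * (q * G) := by rw [hG]; ring
        _ ≤ r * m := Nat.mul_le_mul_left _ hq
        _ ≤ (P + r) * m := Nat.mul_le_mul_right _ (Nat.le_add_left _ _)
    obtain ⟨b, hb⟩ := Nat.exists_eq_add_of_le hle
    have := (h b).2 (by
      have h1 : q * ((P + r) * G') ≤ r * m := by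
        rw [hG]
        calc q * (r * G) = r * (q * G) := by ring
          _ ≤ r * m := Nat.mul_le_mul_left _ hq
      have h2 : (P + r) * m = (P + r) * (q * G') + (P + r) * b := by rw [hb]; ring
      nlinarith)
    omega
  · intro hq
    by_contra! hlt
    have hm : m = (m - q * G') + q * G' := by omega
    have := (h (m - q * G')).1 (by
      have h1 : r * m ≤ q * ((P + r) * G') := by
        rw [hG]
        calc r * m ≤ r * (q * G) := Nat.mul_le_mul_left _ hq
          _ = q * (r * G) := by ring
      generalize m - q * G' = b at hm
      nlinarith)
    omega

theorem weight_eq_prod {V : Type} [DecidableEq V] (g : V → ℕ) (M : Multiset V) {s : Finset V}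
    (hs : M.toFinset ⊆ s) : weight g M = ∏ x ∈ s, (g x).choose (M.count x) :=
  Finset.prod_subset hs fun x _ hx => by
    rw [Multiset.mem_toFinset] at hx
    rw [Multiset.count_eq_zero_of_notMem hx, Nat.choose_zero_right]

theorem count_le_of_weight_pos {V : Type} [DecidableEq V] {g : V → ℕ} {M : Multiset V}
    (h : 0 < weight g M) (x : V) : M.count x ≤ g x := by
  by_contra! hlt
  have hx : x ∈ M.toFinset := by
    rw [Multiset.mem_toFinset, ← Multiset.count_pos]
    omega
  exact h.ne' (Finset.prod_eq_zero hx (Nat.choose_eq_zero_of_lt hlt))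

theorem count_edgeVerts {V E H : Type} [Fintype H] [DecidableEq V] [DecidableEq E]
    (ψ : H → V) (φ : H → E) (e : E) (v : V) :
    (edgeVerts ψ φ e).count v = (Finset.univ.filter fun h => φ h = e ∧ ψ h = v).card := by
  rw [edgeVerts, Multiset.count_map, ← Finset.filter_val, Finset.filter_filter, Finset.card_def]
  simp only [eq_comm]

theorem map_edgeVerts {V W E H : Type} [Fintype H] [DecidableEq E]
    (ψ : H → W) (φ : H → E) (e : E) (π : W → V) :
    (edgeVerts ψ φ e).map π = edgeVerts (fun h => π (ψ h)) φ e := by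
  simp [edgeVerts, Multiset.map_map]

theorem count_map_ite_eq {W : Type} [DecidableEq W] {α β : W} (hαβ : α ≠ β) (M : Multiset W) :
    (M.map fun w => if w = β then α else w).count α = M.count α + M.count β := by
  induction M using Multiset.induction with
  | empty => simp
  | cons y M ih =>
    simp only [Multiset.map_cons, Multiset.count_cons, ih]
    grind

theorem count_map_ite_of_ne {W : Type} [DecidableEq W] {α β x : W} (hα : x ≠ α) (hβ : x ≠ β)
    (M : Multiset W) : (M.map fun w => if w = β then α else w).count x = M.count x := by
  induction M using Multiset.induction with
  | empty => simp
  | cons y M ih =>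
    simp only [Multiset.map_cons, Multiset.count_cons, ih]
    grind

theorem count_map_ite_self {W : Type} [DecidableEq W] {α β : W} (hαβ : α ≠ β) (M : Multiset W) :
    (M.map fun w => if w = β then α else w).count β = 0 := by
  induction M using Multiset.induction with
  | empty => simp
  | cons y M ih =>
    simp only [Multiset.map_cons, Multiset.count_cons, ih]
    grind

/-- The weights after splitting one vertex `β` off a vertex `α`, in relation to the weight before
the splitting. -/
theorem weight_update {W : Type} [DecidableEq W] {g : W → ℕ} {α β : W} {n : ℕ} (hαβ : α ≠ β)
    (hα : g α = n + 1) (hβ : g β = 0) (M : Multiset W) :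
    ∃ R, weight g (M.map fun w => if w = β then α else w) =
        (n + 1).choose (M.count α + M.count β) * R ∧
      weight (Function.update (Function.update g α n) β 1) M =
        n.choose (M.count α) * Nat.choose 1 (M.count β) * R := by
  set s := (M.toFinset.erase α).erase β with hs
  set N := M.map fun w => if w = β then α else w with hN
  have hcount : ∀ x, x ≠ α → x ≠ β → N.count x = M.count x := fun x hxα hxβ =>
    count_map_ite_of_ne hxα hxβ M
  have hcountβ : N.count β = 0 := count_map_ite_self hαβ M
  have hcountα : N.count α = M.count α + M.count β := count_map_ite_eq hαβ M
  have hsub : M.toFinset ⊆ insert α (insert β s) := by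
    intro x hx
    simp only [hs, Finset.mem_insert, Finset.mem_erase]
    tauto
  have hsub' : N.toFinset ⊆ insert α (insert β s) := by
    intro x hx
    by_cases hxα : x = α
    · simp [hxα]
    by_cases hxβ : x = β
    · simp [hxβ]
    refine hsub ?_
    rw [Multiset.mem_toFinset, ← Multiset.count_pos] at hx ⊢
    rwa [← hcount x hxα hxβ]
  have hβs : β ∉ s := by simp [hs]
  have hαs : α ∉ insert β s := by simp [hs, hαβ]
  refine ⟨∏ x ∈ s, (g x).choose (M.count x), ?_, ?_⟩
  · rw [weight_eq_prod g N hsub', Finset.prod_insert hαs, Finset.prod_insert hβs, hcountα, hcountβ,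
      hα, Nat.choose_zero_right, one_mul]
    congr 1
    refine Finset.prod_congr rfl fun x hx => ?_
    rw [hcount]
    · rintro rfl
      exact hαs (Finset.mem_insert_of_mem hx)
    · rintro rfl
      exact hβs hx
  · rw [weight_eq_prod _ M hsub, Finset.prod_insert hαs, Finset.prod_insert hβs, ← mul_assoc,
      Function.update_self, Function.update_of_ne hαβ, Function.update_self]
    congr 1
    refine Finset.prod_congr rfl fun x hx => ?_
    rw [Function.update_of_ne, Function.update_of_ne]
    · rintro rfl
      exact hαs (Finset.mem_insert_of_mem hx)
    · rintro rfl
      exact hβs hx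

/-- The edges of `Q` with vertex multiset `N` have `N.count α` hinges each at `α`. -/
theorem card_filter_edgeVerts {V E H : Type} [Fintype H] [DecidableEq V] [DecidableEq E]
    (ψ : H → V) (φ : H → E) (Q : Finset E) (N : Multiset V) (α : V) :
    (Finset.univ.filter fun h => ψ h = α ∧ φ h ∈ Q ∧ edgeVerts ψ φ (φ h) = N).card =
      N.count α * multOn ψ φ Q N := by
  rw [multOn, mul_comm, ← smul_eq_mul, ← Finset.sum_const,
    Finset.card_eq_sum_card_fiberwise (f := φ) (t := Q.filter fun e => edgeVerts ψ φ e = N)]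
  · refine Finset.sum_congr rfl fun e he => ?_
    rw [Finset.mem_filter] at he
    rw [← he.2, count_edgeVerts, Finset.filter_filter]
    congr 1
    ext h
    simp only [Finset.mem_filter, Finset.mem_univ, true_and]
    constructor
    · exact fun h => ⟨h.2, h.1.1⟩
    · rintro ⟨rfl, h⟩
      exact ⟨⟨h, he.1, rfl⟩, rfl⟩
  · intro h hh
    simpa using (Finset.mem_filter.1 hh).2.2

/-- Shares of all relevant sets of hinges at `α` can be chosen simultaneously. -/
theorem exists_hinges_share {W E H C : Type} [Fintype E] [Fintype H] [Fintype C] [DecidableEq W]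
    [DecidableEq E] [DecidableEq C] (ψ : H → W) (φ : H → E) (K : E → C) (α : W) (n : ℕ)
    (hn : 0 < n) :
    ∃ B : Finset H, (∀ h ∈ B, ψ h = α) ∧
      (∀ e, IsShare n ((edgeVerts ψ φ e).count α) (B.filter fun h => φ h = e).card) ∧
      ∀ Q, IsColorClass K Q →
        IsShare n (degOn ψ φ Q α) (B.filter fun h => φ h ∈ Q).card ∧
        ∀ N, IsShare n (N.count α * multOn ψ φ Q N)
          (B.filter fun h => φ h ∈ Q ∧ edgeVerts ψ φ (φ h) = N).card := by
  let T := Set.range (edgeVerts ψ φ)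
  obtain ⟨B, hBD, hall, hc, he, hu, ht⟩ := exists_isShare_subset
    (Finset.univ.filter fun h => ψ h = α) (fun h => K (φ h)) φ
    (fun e => ((⟨edgeVerts ψ φ e, e, rfl⟩ : T), K e)) Prod.fst n hn
  refine ⟨B, fun h hh => by simpa using hBD hh, fun e => ?_, ?_⟩
  · have := he e
    rw [Finset.filter_filter] at this
    rw [count_edgeVerts]
    simpa only [and_comm] using this
  have hnone : ∀ N, N ∉ T → ∀ e, edgeVerts ψ φ e ≠ N := fun N hN e h => hN ⟨e, h⟩
  have hzero : ∀ Q : Finset E, ∀ N, N ∉ T → IsShare n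
      (Finset.univ.filter fun h => ψ h = α ∧ φ h ∈ Q ∧ edgeVerts ψ φ (φ h) = N).card
      (B.filter fun h => φ h ∈ Q ∧ edgeVerts ψ φ (φ h) = N).card := by
    intro Q N hN
    simp only [hnone N hN, and_false, Finset.filter_false, Finset.card_empty]
    intro q
    simp only [zero_le, implies_true, and_true]
    intro h
    nlinarith
  rintro Q (rfl | ⟨j, rfl⟩)
  · refine ⟨by simpa [degOn] using hall, fun N => ?_⟩
    rw [← card_filter_edgeVerts]
    by_cases hN : N ∈ T
    · have := ht ⟨N, hN⟩
      rw [Finset.filter_filter] at this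
      simpa [Subtype.ext_iff] using this
    · exact hzero _ N hN
  · refine ⟨by simpa [degOn, Finset.filter_filter] using hc j, fun N => ?_⟩
    rw [← card_filter_edgeVerts]
    by_cases hN : N ∈ T
    · have := hu (⟨N, hN⟩, j)
      rw [Finset.filter_filter] at this
      simpa [Subtype.ext_iff, and_comm] using this
    · exact hzero _ N hN

/-- A vertex `β` of weight `1` can be split off a vertex `α` of weight `n + 1`. -/
theorem exists_split_vertex {W E H C : Type} [Fintype E] [Fintype H] [Fintype C] [DecidableEq W]
    [DecidableEq E] [DecidableEq C] (ψ : H → W) (φ : H → E) (K : E → C) {g : W → ℕ} {α β : W}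
    {n : ℕ} (hαβ : α ≠ β) (hα : g α = n + 1) (hβ : g β = 0)
    (hpos : ∀ e, 0 < weight g (edgeVerts ψ φ e)) :
    ∃ ψ' : H → W, (∀ h, (if ψ' h = β then α else ψ' h) = ψ h) ∧
      (∀ e, 0 < weight (Function.update (Function.update g α n) β 1) (edgeVerts ψ' φ e)) ∧
      ∀ Q, IsColorClass K Q →
        (∀ w, BoundsTransfer (degOn ψ φ Q (if w = β then α else w)) (g (if w = β then α else w))
          (degOn ψ' φ Q w) (Function.update (Function.update g α n) β 1 w)) ∧
        ∀ M : Multiset W, BoundsTransfer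
          (multOn ψ φ Q (M.map fun w => if w = β then α else w))
          (weight g (M.map fun w => if w = β then α else w))
          (multOn ψ' φ Q M) (weight (Function.update (Function.update g α n) β 1) M) := by
  obtain ⟨B, hB, hBe, hBQ⟩ := exists_hinges_share ψ φ K α (n + 1) n.succ_pos
  have hψβ : ∀ h, ψ h ≠ β := by
    intro h hh
    have h1 := count_le_of_weight_pos (hpos (φ h)) β
    rw [hβ, Nat.le_zero, count_edgeVerts, Finset.card_eq_zero] at h1
    exact Finset.notMem_empty h (h1 ▸ by simp [hh])
  classical
  let ψ' : H → W := fun h => if h ∈ B then β else ψ h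
  have hψ'B : ∀ h, ψ' h = β ↔ h ∈ B := by
    intro h
    simp only [ψ']
    split_ifs with h1
    · simp [h1]
    · simp [h1, hψβ]
  have hπ : ∀ h, (if ψ' h = β then α else ψ' h) = ψ h := by
    intro h
    by_cases h1 : h ∈ B
    · rw [if_pos ((hψ'B h).2 h1), hB h h1]
    · rw [if_neg (mt (hψ'B h).1 h1)]
      simp [ψ', h1]
  have hverts : ∀ e, (edgeVerts ψ' φ e).map (fun w => if w = β then α else w) =
      edgeVerts ψ φ e := by
    intro e
    rw [map_edgeVerts]
    simp only [hπ]
  have hcountβ : ∀ e, (edgeVerts ψ' φ e).count β = (B.filter fun h => φ h = e).card := by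
    intro e
    rw [count_edgeVerts]
    congr 1
    ext h
    simp [hψ'B, and_comm]
  have hone : ∀ e, (B.filter fun h => φ h = e).card ≤ 1 := by
    intro e
    refine (hBe e 1).2 ?_
    rw [one_mul, ← hα]
    exact count_le_of_weight_pos (hpos e) α
  have hiff : ∀ e M, edgeVerts ψ' φ e = M ↔
      edgeVerts ψ φ e = M.map (fun w => if w = β then α else w) ∧
        (B.filter fun h => φ h = e).card = M.count β := by
    intro e M
    constructor
    · rintro rfl
      exact ⟨(hverts e).symm, (hcountβ e).symm⟩
    · rintro ⟨h1, h2⟩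
      rw [← hverts] at h1
      rw [← hcountβ] at h2
      ext x
      by_cases hxβ : x = β
      · rw [hxβ, h2]
      have h3 := congrArg (Multiset.count x) h1
      by_cases hxα : x = α
      · rw [hxα, count_map_ite_eq hαβ, count_map_ite_eq hαβ] at h3
        rw [hxα]
        omega
      · rwa [count_map_ite_of_ne hxα hxβ, count_map_ite_of_ne hxα hxβ] at h3
  have hcard : ∀ (Q : Finset E) N, (B.filter fun h => φ h ∈ Q ∧ edgeVerts ψ φ (φ h) = N).card =
      ((Q.filter fun e => edgeVerts ψ φ e = N).filter fun e =>
        (B.filter fun h => φ h = e).card = 1).card := by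
    intro Q N
    rw [Finset.card_eq_sum_card_fiberwise (f := φ) (t := Q.filter fun e => edgeVerts ψ φ e = N),
      Finset.card_filter]
    · refine Finset.sum_congr rfl fun e he => ?_
      rw [Finset.mem_filter] at he
      have : ((B.filter fun h => φ h ∈ Q ∧ edgeVerts ψ φ (φ h) = N).filter fun h => φ h = e) =
          B.filter fun h => φ h = e := by
        ext h
        simp only [Finset.mem_filter]
        constructor
        · exact fun h => ⟨h.1.1, h.2⟩
        · rintro ⟨h, rfl⟩
          exact ⟨⟨h, he⟩, rfl⟩
      rw [this]
      have := hone e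
      split_ifs <;> omega
    · intro h hh
      simpa using (Finset.mem_filter.1 hh).2
  have hdeg : ∀ Q, IsColorClass K Q → ∀ w, BoundsTransfer
      (degOn ψ φ Q (if w = β then α else w)) (g (if w = β then α else w))
      (degOn ψ' φ Q w) (Function.update (Function.update g α n) β 1 w) := by
    intro Q hQ w
    have hshare := (hBQ Q hQ).1
    rw [← one_mul (degOn ψ φ Q α)] at hshare
    by_cases hwβ : w = β
    · subst hwβ
      have : degOn ψ' φ Q w = (B.filter fun h => φ h ∈ Q).card := by
        rw [degOn]
        congr 1
        ext h
        simp [hψ'B]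
      rw [if_pos rfl, this, Function.update_self, hα]
      exact hshare.boundsTransfer (by ring)
    by_cases hwα : w = α
    · subst hwα
      have : degOn ψ' φ Q w = degOn ψ φ Q w - (B.filter fun h => φ h ∈ Q).card := by
        rw [degOn, degOn, ← Finset.card_sdiff_of_subset]
        · congr 1
          ext h
          by_cases hhB : h ∈ B <;> simp [ψ', hhB, Ne.symm hwβ]
        · intro h hh
          rw [Finset.mem_filter] at hh
          simp [hB h hh.1, hh.2]
      rw [if_neg hwβ, this, Function.update_of_ne hwβ, Function.update_self, hα]
      exact hshare.boundsTransfer_sub n.succ_pos (by omega) (by simp [mul_comm])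
    · have : degOn ψ' φ Q w = degOn ψ φ Q w := by
        rw [degOn, degOn]
        congr 1
        ext h
        by_cases hhB : h ∈ B
        · simp [ψ', hhB, Ne.symm hwβ, hB h hhB, Ne.symm hwα]
        · simp [ψ', hhB]
      rw [if_neg hwβ, this, Function.update_of_ne hwβ, Function.update_of_ne hwα]
      exact BoundsTransfer.refl _ _
  have hmult : ∀ Q, IsColorClass K Q → ∀ M : Multiset W, BoundsTransfer
      (multOn ψ φ Q (M.map fun w => if w = β then α else w))
      (weight g (M.map fun w => if w = β then α else w))
      (multOn ψ' φ Q M) (weight (Function.update (Function.update g α n) β 1) M) := by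
    intro Q hQ M
    obtain ⟨R, hR, hR'⟩ := weight_update hαβ hα hβ M
    set N := M.map fun w => if w = β then α else w with hN
    have hshare := (hBQ Q hQ).2 N
    rw [hcard] at hshare
    have hmult' : multOn ψ' φ Q M = ((Q.filter fun e => edgeVerts ψ φ e = N).filter fun e =>
        (B.filter fun h => φ h = e).card = M.count β).card := by
      rw [multOn, Finset.filter_filter]
      simp only [hiff, ← hN]
    have hNα : N.count α = M.count α + M.count β := count_map_ite_eq hαβ M
    rw [hNα] at hshare
    rw [hR, hR', hmult']
    obtain h0 | h1 | h2 : M.count β = 0 ∨ M.count β = 1 ∨ 2 ≤ M.count β := by omega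
    · rw [h0, add_zero] at hshare ⊢
      rw [Nat.choose_zero_right, mul_one]
      have hsub : ((Q.filter fun e => edgeVerts ψ φ e = N).filter fun e =>
          (B.filter fun h => φ h = e).card = 0).card = multOn ψ φ Q N -
            ((Q.filter fun e => edgeVerts ψ φ e = N).filter fun e =>
              (B.filter fun h => φ h = e).card = 1).card := by
        rw [multOn, ← Finset.card_filter_add_card_filter_not (p := fun e =>
          (B.filter fun h => φ h = e).card = 1) (s := Q.filter fun e => edgeVerts ψ φ e = N),
          Nat.add_sub_cancel_left]
        congr 1
        refine Finset.filter_congr fun e _ => ?_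
        have := hone e
        omega
      rw [hsub]
      by_cases hle : M.count α ≤ n + 1
      · refine hshare.boundsTransfer_sub n.succ_pos hle ?_
        rw [← mul_assoc, ← mul_assoc, mul_comm (n + 1), Nat.choose_mul_succ_eq,
          mul_comm ((n + 1).choose _)]
      · have hempty : multOn ψ φ Q N = 0 := by
          rw [multOn, Finset.card_eq_zero, Finset.filter_eq_empty_iff]
          rintro e - he
          refine (hpos e).ne' ?_
          rw [he, hR, h0, add_zero, Nat.choose_eq_zero_of_lt (not_le.1 hle), zero_mul]
        rw [hempty, Nat.zero_sub, Nat.choose_eq_zero_of_lt (by omega : n < M.count α), zero_mul]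
        exact boundsTransfer_zero _ _
    · rw [h1] at hshare ⊢
      refine hshare.boundsTransfer ?_
      rw [Nat.choose_self, mul_one, ← mul_assoc, ← mul_assoc, Nat.add_one_mul_choose_eq,
        mul_comm ((n + 1).choose _)]
    · rw [Nat.choose_eq_zero_of_lt (by omega : 1 < M.count β), mul_zero, zero_mul,
        Finset.filter_false_of_mem, Finset.card_empty]
      · exact boundsTransfer_zero _ _
      · intro e _
        have := hone e
        omega
  refine ⟨ψ', hπ, fun e => ?_, fun Q hQ => ⟨hdeg Q hQ, hmult Q hQ⟩⟩
  refine Nat.pos_of_ne_zero fun h0 => ?_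
  have h1 := hmult Finset.univ (Or.inl rfl) (edgeVerts ψ' φ e)
  rw [hverts] at h1
  have h2 := h1.eq_zero (hpos e) h0
  rw [multOn, Finset.card_eq_zero] at h2
  exact Finset.notMem_empty e (h2 ▸ by simp)

/-- The weights on `V × ℕ` when vertices `(x, a)` with `s x ≤ a < g x` have been split off a vertex
`(x, 0)`, which keeps weight `s x`. -/
def splitWeight {V : Type} (g s : V → ℕ) (w : V × ℕ) : ℕ :=
  if w.2 = 0 then s w.1 else if s w.1 ≤ w.2 ∧ w.2 < g w.1 then 1 else 0

theorem update_splitWeight {V : Type} [DecidableEq V] (g s : V → ℕ) (x : V) (h0 : 0 < s x)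
    (hx : s x < g x) :
    Function.update (Function.update (splitWeight g (Function.update s x (s x + 1))) (x, 0) (s x))
      (x, s x) 1 = splitWeight g s := by
  ext ⟨y, a⟩
  by_cases hyx : y = x
  · subst hyx
    simp only [Function.update_apply, splitWeight, Prod.mk.injEq, true_and, if_true]
    grind
  · simp [splitWeight, hyx]

theorem weight_map_mk_zero {V : Type} [DecidableEq V] (g : V → ℕ) (M : Multiset V) :
    weight (splitWeight g g) (M.map fun x => (x, 0)) = weight g M := by
  have hinj : Function.Injective fun x : V => (x, 0) := fun x y h => (Prod.mk.inj h).1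
  have : (M.map fun x => (x, 0)).toFinset = M.toFinset.image fun x => (x, 0) := by
    ext
    simp
  rw [weight, weight, this, Finset.prod_image fun x _ y _ h => hinj h]
  refine Finset.prod_congr rfl fun x _ => ?_
  rw [Multiset.count_map_eq_count' (fun x : V => (x, 0)) M hinj]
  simp [splitWeight]

/-- Every vertex `x` can be split into one vertex of weight `s x` and `g x - s x` vertices of weight
`1`. -/
theorem exists_split {V E H C : Type} [Fintype V] [Fintype E] [Fintype H] [Fintype C]
    [DecidableEq V] [DecidableEq E] [DecidableEq C] (ψ : H → V) (φ : H → E) (K : E → C)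
    (g : V → ℕ) (hpos : ∀ e, 0 < weight g (edgeVerts ψ φ e)) (s : V → ℕ) (hs0 : ∀ x, 0 < s x)
    (hsg : ∀ x, s x ≤ g x) :
    ∃ ψ' : H → V × ℕ, (∀ h, (ψ' h).1 = ψ h) ∧
      (∀ e, 0 < weight (splitWeight g s) (edgeVerts ψ' φ e)) ∧
      ∀ Q, IsColorClass K Q →
        (∀ w, BoundsTransfer (degOn ψ φ Q w.1) (g w.1) (degOn ψ' φ Q w) (splitWeight g s w)) ∧
        ∀ M : Multiset (V × ℕ), BoundsTransfer (multOn ψ φ Q (M.map Prod.fst))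
          (weight g (M.map Prod.fst)) (multOn ψ' φ Q M) (weight (splitWeight g s) M) := by
  induction hm : ∑ x, (g x - s x) using Nat.strong_induction_on generalizing s with
  | _ m ih =>
  by_cases hlt : ∃ x, s x < g x
  · obtain ⟨x, hx⟩ := hlt
    have hlt : ∑ y, (g y - Function.update s x (s x + 1) y) < m := by
      rw [← hm]
      refine Finset.sum_lt_sum (fun y _ => ?_) ⟨x, Finset.mem_univ x, ?_⟩
      · rw [Function.update_apply]
        split_ifs with h
        · rw [h]
          omega
        · rfl
      · rw [Function.update_self]
        omega
    obtain ⟨ψ₁, hfst, hpos₁, hψ₁⟩ := ih _ hlt (Function.update s x (s x + 1))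
      (fun y => by rw [Function.update_apply]; split_ifs <;> simp [hs0])
      (fun y => by
        rw [Function.update_apply]
        split_ifs with h
        · rw [h]
          omega
        · exact hsg y) rfl
    have hne : (x, 0) ≠ (x, s x) := by
      have := hs0 x
      simp only [ne_eq, Prod.mk.injEq, true_and]
      omega
    obtain ⟨ψ', hπ, hpos', hψ'⟩ := exists_split_vertex ψ₁ φ K (n := s x) hne
      (by simp [splitWeight]) (by simp [splitWeight, (hs0 x).ne']) hpos₁
    rw [update_splitWeight g s x (hs0 x) hx] at hpos' hψ'
    have hπfst : ∀ w : V × ℕ, (if w = (x, s x) then (x, 0) else w).1 = w.1 := by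
      intro w
      split_ifs with h
      · rw [h]
      · rfl
    refine ⟨ψ', fun h => by rw [← hfst, ← hπ, hπfst], hpos', fun Q hQ => ⟨fun w => ?_, fun M => ?_⟩⟩
    · have := (hψ₁ Q hQ).1 (if w = (x, s x) then (x, 0) else w)
      rw [hπfst] at this
      exact this.trans ((hψ' Q hQ).1 w)
    · have := (hψ₁ Q hQ).2 (M.map fun w => if w = (x, s x) then (x, 0) else w)
      rw [Multiset.map_map] at this
      simp only [Function.comp_def, hπfst] at this
      exact this.trans ((hψ' Q hQ).2 M)
  · have hsg' : s = g := funext fun x => le_antisymm (hsg x) (not_lt.1 fun h => hlt ⟨x, h⟩)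
    subst hsg'
    have hverts : ∀ e, edgeVerts (fun h => (ψ h, 0)) φ e =
        (edgeVerts ψ φ e).map fun x => (x, 0) := fun e => by rw [map_edgeVerts]
    refine ⟨fun h => (ψ h, 0), fun h => rfl, fun e => ?_, fun Q _ => ⟨fun w => ?_, fun M => ?_⟩⟩
    · rw [hverts, weight_map_mk_zero]
      exact hpos e
    · obtain ⟨x, a⟩ := w
      by_cases ha : a = 0
      · subst ha
        simpa [degOn, splitWeight] using BoundsTransfer.refl _ _
      · have h1 : degOn (fun h => (ψ h, 0)) φ Q (x, a) = 0 := by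
          simp [degOn, Ne.symm ha]
        have h2 : splitWeight s s (x, a) = 0 := by
          simp only [splitWeight, ha, if_false]
          rw [if_neg]
          omega
        rw [h1, h2]
        exact boundsTransfer_zero _ _
    · by_cases hM : ∀ w ∈ M, w.2 = 0
      · have hM' : M = (M.map Prod.fst).map fun x => (x, 0) := by
          rw [Multiset.map_map]
          conv_lhs => rw [← Multiset.map_id M]
          refine Multiset.map_congr rfl fun w hw => ?_
          exact Prod.ext rfl (hM w hw)
        generalize M.map Prod.fst = N at hM' ⊢
        subst hM'
        have h1 : multOn (fun h => (ψ h, 0)) φ Q (N.map fun x => (x, 0)) = multOn ψ φ Q N := by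
          simp only [multOn, hverts]
          congr 1
          refine Finset.filter_congr fun e _ => ?_
          exact (Multiset.map_injective fun x y h => (Prod.mk.inj h).1).eq_iff
        rw [h1, weight_map_mk_zero]
        exact BoundsTransfer.refl _ _
      · push Not at hM
        obtain ⟨w, hw, hw0⟩ := hM
        have h1 : multOn (fun h => (ψ h, 0)) φ Q M = 0 := by
          rw [multOn, Finset.card_eq_zero, Finset.filter_eq_empty_iff]
          rintro e - rfl
          rw [hverts, Multiset.mem_map] at hw
          obtain ⟨y, -, rfl⟩ := hw
          exact hw0 rfl
        have h2 : weight (splitWeight s s) M = 0 := by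
          by_contra h
          have h3 := count_le_of_weight_pos (Nat.pos_of_ne_zero h) w
          have h4 := Multiset.count_pos.2 hw
          simp only [splitWeight, hw0, if_false] at h3
          rw [if_neg] at h3 <;> omega
        rw [h1, h2]
        exact boundsTransfer_zero _ _

theorem weight_eq_gtilde {V : Type} [DecidableEq V] (g : V → ℕ) (x y z : V) :
    weight g {x, y, z} = gtilde g x y z := by
  have hs : ({x, y, z} : Multiset V).toFinset ⊆ ({x, y, z} : Finset V) := fun v hv => by
    simpa using hv
  rw [weight_eq_prod g _ hs, gtilde]
  by_cases hxy : x = y <;> by_cases hyz : y = z <;> by_cases hxz : x = z <;>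
    simp_all [Multiset.count_cons, Multiset.count_singleton, Finset.prod_insert, eq_comm] <;> ring

/-- The vertex multisets of the edges have positive weight. -/
theorem weight_edgeVerts_pos {V E H : Type} [Fintype E] [Fintype H] [DecidableEq V]
    [DecidableEq E] (ψ : H → V) (φ : H → E)
    (h3 : ∀ e : E, (Finset.univ.filter fun h => φ h = e).card = 3) (g : V → ℕ)
    (hg : ∀ x, 0 < g x) (hg2 : ∀ x : V, g x ≤ 2 → mF ψ φ x x x = 0)
    (hg1 : ∀ x y : V, g x = 1 → mF ψ φ x x y = 0) (e : E) :
    0 < weight g (edgeVerts ψ φ e) := by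
  have hcard : (edgeVerts ψ φ e).card = 3 := (Multiset.card_map _ _).trans (h3 e)
  obtain ⟨x, y, z, hxyz⟩ := Multiset.card_eq_three.1 hcard
  have hmF : ∀ a b c : V, ({x, y, z} : Multiset V) = {a, b, c} → mF ψ φ a b c ≠ 0 := by
    intro a b c h
    rw [mF, Finset.card_ne_zero]
    exact ⟨e, Finset.mem_filter.2 ⟨Finset.mem_univ e, hxyz.trans h⟩⟩
  have htwo : ∀ a b : V, ({x, y, z} : Multiset V) = {a, a, b} → 2 ≤ g a := by
    intro a b h
    by_contra! hlt
    exact hmF a a b h (hg1 a b (by have := hg a; omega))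
  have hthree : ∀ a : V, ({x, y, z} : Multiset V) = {a, a, a} → 3 ≤ g a := by
    intro a h
    by_contra! hlt
    exact hmF a a a h (hg2 a (by omega))
  rw [hxyz, weight_eq_gtilde, gtilde]
  split_ifs with h h h h
  · obtain ⟨rfl, rfl⟩ := h
    exact Nat.choose_pos (hthree x rfl)
  · subst h
    exact Nat.mul_pos (Nat.choose_pos (htwo x z rfl)) (hg z)
  · subst h
    exact Nat.mul_pos (Nat.choose_pos (htwo x y (by simp [Multiset.pair_comm y x]))) (hg y)
  · subst h
    exact Nat.mul_pos (Nat.choose_pos (htwo y x (by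
      rw [Multiset.insert_eq_cons, Multiset.insert_eq_cons, Multiset.cons_swap,
        ← Multiset.insert_eq_cons x, Multiset.pair_comm]
      rfl))) (hg x)
  · exact Nat.mul_pos (Nat.mul_pos (hg x) (hg y)) (hg z)

/-- **Detachment theorem for amalgamated 3-uniform hypergraphs.**
`F` is given by `ψ : H → V` (hinges to vertices) and the surjection
`φ : H → E` (hinges to edges), every edge being incident with exactly three
hinges, together with a `k`-edge-coloring `K`.  Given `g : V → ℕ₊` with
`g x ≤ 2 → m_F(x³) = 0` and `g x = 1 → m_F(x²,y) = 0`, there is a 3-uniform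
`g`-detachment `G` of `F`; its vertices are the pairs `(x, a)` with
`a < g x` (so the amalgamation function `Ψ` is the first projection, and
`|Ψ⁻¹ x| = g x`), its hinge-to-vertex map is `ψ'` with `Ψ ∘ ψ' = ψ`, and
conditions (A1)–(A4) hold. -/
theorem detachment_3uniform {V E H : Type} [Fintype V] [Fintype E] [Fintype H]
    [DecidableEq V] [DecidableEq E] [DecidableEq H]
    (ψ : H → V) (φ : H → E) (hφ : Function.Surjective φ)
    (h3 : ∀ e : E, (Finset.univ.filter fun h => φ h = e).card = 3)
    (k : ℕ) (K : E → Fin k)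
    (g : V → ℕ) (hg : ∀ x, 0 < g x)
    (hg2 : ∀ x : V, g x ≤ 2 → mF ψ φ x x x = 0)
    (hg1 : ∀ x y : V, g x = 1 → mF ψ φ x x y = 0) :
    ∃ ψ' : H → V × ℕ,
      -- `ψ'` describes a `g`-detachment with amalgamation function `Ψ = Prod.fst`:
      (∀ h : H, (ψ' h).1 = ψ h ∧ (ψ' h).2 < g (ψ h)) ∧
      -- the detachment is 3-uniform: every edge is incident with three hinges
      -- attached to three pairwise distinct vertices
      (∀ e : E, ∃ u v w : V × ℕ, u ≠ v ∧ u ≠ w ∧ v ≠ w ∧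
        edgeVerts ψ' φ e = ({u, v, w} : Multiset (V × ℕ))) ∧
      -- (A1)
      (∀ x : V, ∀ a : ℕ, a < g x →
        approx (degF ψ' (x, a)) ((degF ψ x : ℚ) / (g x : ℚ))) ∧
      -- (A2)
      (∀ x : V, ∀ a : ℕ, a < g x → ∀ j : Fin k,
        approx (degFc ψ' φ K j (x, a)) ((degFc ψ φ K j x : ℚ) / (g x : ℚ))) ∧
      -- (A3)
      (∀ x y z : V,
        (x = y → y = z → 3 ≤ g x) →
        (x = y → x ≠ z → 2 ≤ g x) →
        (x = z → x ≠ y → 2 ≤ g x) →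
        (y = z → y ≠ x → 2 ≤ g y) →
        ∀ a b c : ℕ, a < g x → b < g y → c < g z →
          (x, a) ≠ (y, b) → (x, a) ≠ (z, c) → (y, b) ≠ (z, c) →
          approx (mF ψ' φ (x, a) (y, b) (z, c))
            ((mF ψ φ x y z : ℚ) / (gtilde g x y z : ℚ))) ∧
      -- (A4)
      (∀ x y z : V,
        (x = y → y = z → 3 ≤ g x) →
        (x = y → x ≠ z → 2 ≤ g x) →
        (x = z → x ≠ y → 2 ≤ g x) →
        (y = z → y ≠ x → 2 ≤ g y) →
        ∀ a b c : ℕ, a < g x → b < g y → c < g z →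
          (x, a) ≠ (y, b) → (x, a) ≠ (z, c) → (y, b) ≠ (z, c) →
          ∀ j : Fin k,
          approx (mFc ψ' φ K j (x, a) (y, b) (z, c))
            ((mFc ψ φ K j x y z : ℚ) / (gtilde g x y z : ℚ))) := by
  obtain ⟨ψ', hfst, hpos, hbd⟩ := exists_split ψ φ K g
    (weight_edgeVerts_pos ψ φ h3 g hg hg2 hg1) (fun _ => 1) (fun _ => Nat.one_pos) hg
  have hle : ∀ w, splitWeight g (fun _ => 1) w ≤ 1 := by
    intro w
    rw [splitWeight]
    split_ifs <;> omega
  have hone : ∀ x a, a < g x → splitWeight g (fun _ => 1) (x, a) = 1 := by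
    intro x a ha
    simp only [splitWeight]
    split_ifs <;> omega
  have hdeg : ∀ Q, IsColorClass K Q → ∀ x a, a < g x →
      approx (degOn ψ' φ Q (x, a)) ((degOn ψ φ Q x : ℚ) / (g x : ℚ)) := by
    intro Q hQ x a ha
    have := (hbd Q hQ).1 (x, a)
    rw [hone x a ha] at this
    exact this.approx_div (hg x)
  have hmult : ∀ Q, IsColorClass K Q → ∀ x y z : V,
      (x = y → y = z → 3 ≤ g x) → (x = y → x ≠ z → 2 ≤ g x) → (x = z → x ≠ y → 2 ≤ g x) →
      (y = z → y ≠ x → 2 ≤ g y) → ∀ a b c : ℕ, a < g x → b < g y → c < g z →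
      (x, a) ≠ (y, b) → (x, a) ≠ (z, c) → (y, b) ≠ (z, c) →
      approx (multOn ψ' φ Q {(x, a), (y, b), (z, c)})
        ((multOn ψ φ Q {x, y, z} : ℚ) / (gtilde g x y z : ℚ)) := by
    intro Q hQ x y z h1 h2 h4 h5 a b c ha hb hc hab hac hbc
    have := (hbd Q hQ).2 {(x, a), (y, b), (z, c)}
    rw [weight_eq_gtilde (splitWeight g fun _ => 1)] at this
    simp only [Multiset.insert_eq_cons, Multiset.map_cons, Multiset.map_singleton] at this
    simp only [← Multiset.insert_eq_cons, weight_eq_gtilde] at this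
    have hone' : gtilde (splitWeight g fun _ => 1) (x, a) (y, b) (z, c) = 1 := by
      simp [gtilde, hab, hac, hbc, hone, ha, hb, hc]
    rw [hone'] at this
    refine this.approx_div ?_
    rw [gtilde]
    split_ifs with h h h h
    · exact Nat.choose_pos (h1 h.1 h.2)
    · exact Nat.mul_pos (Nat.choose_pos (h2 h (by grind))) (hg z)
    · exact Nat.mul_pos (Nat.choose_pos (h4 h (by grind))) (hg y)
    · exact Nat.mul_pos (Nat.choose_pos (h5 h (by grind))) (hg x)
    · exact Nat.mul_pos (Nat.mul_pos (hg x) (hg y)) (hg z)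
  refine ⟨ψ', fun h => ⟨hfst h, ?_⟩, fun e => ?_, fun x a ha => ?_, fun x a ha j => ?_,
    fun x y z h1 h2 h4 h5 a b c ha hb hc hab hac hbc => ?_,
    fun x y z h1 h2 h4 h5 a b c ha hb hc hab hac hbc j => ?_⟩
  · have h1 := count_le_of_weight_pos (hpos (φ h)) (ψ' h)
    have h2 : 0 < (edgeVerts ψ' φ (φ h)).count (ψ' h) := by
      rw [count_edgeVerts, Finset.card_pos]
      exact ⟨h, by simp⟩
    have h4 := hg (ψ h)
    simp only [splitWeight, hfst] at h1
    split_ifs at h1 <;> omega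
  · have hcard : (edgeVerts ψ' φ e).card = 3 := (Multiset.card_map _ _).trans (h3 e)
    obtain ⟨u, v, w, huvw⟩ := Multiset.card_eq_three.1 hcard
    have hnodup : (edgeVerts ψ' φ e).Nodup := Multiset.nodup_iff_count_le_one.2 fun x =>
      (count_le_of_weight_pos (hpos e) x).trans (hle x)
    rw [huvw] at hnodup
    simp at hnodup
    exact ⟨u, v, w, by tauto, by tauto, by tauto, huvw⟩
  · simpa [degOn, degF] using hdeg Finset.univ (Or.inl rfl) x a ha
  · simpa [degOn, degFc] using hdeg _ (Or.inr ⟨j, rfl⟩) x a ha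
  · simpa [multOn, mF] using
      hmult Finset.univ (Or.inl rfl) x y z h1 h2 h4 h5 a b c ha hb hc hab hac hbc
  · simpa [multOn, mFc, Finset.filter_filter] using
      hmult _ (Or.inr ⟨j, rfl⟩) x y z h1 h2 h4 h5 a b c ha hb hc hab hac hbc
end

section
/- Let n ≥ 3, let m, λ, k ≥ 1, and let r_1, …, r_k be positive integers such that 3 divides r_i·m·n for each i ∈ {1,…,k} and Σ_{i=1}^k r_i = λ·C(n−1, 2)·m². Then λK_{m,…,m}^3 (with n parts of size m) is (r_1,…,r_k)-factorizable: there exists a function c assigning to each pair (T, l), where T is a 3-element subset of Fin n × Fin m whose elements have pairwise distinct first coordinates and l ∈ Fin λ, a color c(T, l) ∈ {1,…,k}, such that for every vertex v ∈ Fin n × Fin m and every color j, the number of pairs (T, l) with v ∈ T and c(T, l) = j equals r_j. -/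
open Finset in
/-- If every nonempty fiber of `f` and of `g` on `D` has at least two elements, some nonzero
weighting of `D` sums to zero on each of these fibers. -/
theorem exists_ne_zero_fiber_sum_eq_zero.{u, v} {E : Type u} {A B : Type v} [DecidableEq E] [DecidableEq A]
    [DecidableEq B] (D : Finset E) (hD : D.Nonempty) (f : E → A) (g : E → B)
    (hf : ∀ e ∈ D, 2 ≤ #{e' ∈ D | f e' = f e}) (hg : ∀ e ∈ D, 2 ≤ #{e' ∈ D | g e' = g e}) :
    ∃ x : E → ℚ, (∃ e ∈ D, x e ≠ 0) ∧ (∀ i, ∑ e ∈ D with f e = i, x e = 0) ∧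
      ∀ i, ∑ e ∈ D with g e = i, x e = 0 := by
  have image_card {C : Type v} [DecidableEq C] (p : E → C)
      (hp : ∀ e ∈ D, 2 ≤ #{e' ∈ D | p e' = p e}) : 2 * #(D.image p) ≤ #D := by
    refine mul_card_image_le_card D 2 fun b hb => ?_
    obtain ⟨e, he, rfl⟩ := mem_image.1 hb
    exact hp e he
  have sum_off_image {C : Type v} [DecidableEq C] (p : E → C) (y : E → ℚ) (i : C)
      (hi : i ∉ D.image p) : ∑ e ∈ D with p e = i, y e = 0 := by
    rw [filter_false_of_mem, sum_empty]
    exact fun e he h => hi (mem_image.2 ⟨e, he, h⟩)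
  have total {C : Type v} [DecidableEq C] (p : E → C) (y : E → ℚ) :
      ∑ i ∈ D.image p, ∑ e ∈ D with p e = i, y e = ∑ e ∈ D, y e :=
    sum_fiberwise_of_maps_to (fun e he => mem_image_of_mem p he) y
  obtain ⟨e₀, he₀⟩ := hD
  have hb : g e₀ ∈ D.image g := mem_image_of_mem g he₀
  let extend : (D → ℚ) →ₗ[ℚ] (E → ℚ) :=
    { toFun := fun y e => if h : e ∈ D then y ⟨e, h⟩ else 0
      map_add' := fun y z => by ext e; by_cases h : e ∈ D <;> simp [h]
      map_smul' := fun a y => by ext e; by_cases h : e ∈ D <;> simp [h] }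
  let L : (E → ℚ) →ₗ[ℚ] (D.image f → ℚ) × ((D.image g).erase (g e₀) → ℚ) :=
    { toFun := fun y => (fun i => ∑ e ∈ D with f e = i, y e, fun i => ∑ e ∈ D with g e = i, y e)
      map_add' := fun y z => by ext i <;> simp [sum_add_distrib]
      map_smul' := fun a y => by ext i <;> simp [mul_sum] }
  have hker : LinearMap.ker (L ∘ₗ extend) ≠ ⊥ := by
    apply LinearMap.ker_ne_bot_of_finrank_lt
    simp only [Module.finrank_prod, Module.finrank_fintype_fun_eq_card, Fintype.card_coe]
    have h1 := image_card f hf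
    have h2 := image_card g hg
    have h3 := card_erase_lt_of_mem hb
    omega
  obtain ⟨y, hy, hy0⟩ := (Submodule.ne_bot_iff _).1 hker
  have hL : L (extend y) = 0 := hy
  have hA : ∀ i, ∑ e ∈ D with f e = i, extend y e = 0 := fun i => by
    by_cases hi : i ∈ D.image f
    · exact congrFun (congrArg Prod.fst hL) ⟨i, hi⟩
    · exact sum_off_image f _ i hi
  have hB : ∀ i ≠ g e₀, ∑ e ∈ D with g e = i, extend y e = 0 := fun i hne => by
    by_cases hi : i ∈ D.image g
    · exact congrFun (congrArg Prod.snd hL) ⟨i, mem_erase.2 ⟨hne, hi⟩⟩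
    · exact sum_off_image g _ i hi
  refine ⟨extend y, ?_, hA, fun i => ?_⟩
  · obtain ⟨e, he⟩ := Function.ne_iff.1 hy0
    exact ⟨e, e.2, by simpa [extend] using he⟩
  · by_cases hi : i = g e₀
    · have h := total g (extend y)
      rw [← total f, sum_eq_zero fun i _ => hA i, sum_eq_single_of_mem _ hb fun i _ => hB i] at h
      rw [hi, h]
    · exact hB i hi

open Finset in
/-- A fractional point in which all `f`-fiber sums are integers has no `f`-fiber with exactly one
non-integral weight. -/
theorem two_le_card_fractional_fiber {E A : Type*} [DecidableEq A]
    (F : Finset E) (f : E → A) (w : E → ℚ) (hw : ∀ e ∈ F, 0 ≤ w e ∧ w e ≤ 1)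
    (hf : ∀ i, ∃ z : ℤ, ∑ e ∈ F with f e = i, w e = z) (e : E)
    (he : e ∈ F.filter fun e => w e ≠ 0 ∧ w e ≠ 1) :
    2 ≤ #{e' ∈ F.filter fun e => w e ≠ 0 ∧ w e ≠ 1 | f e' = f e} := by
  classical
  by_contra! hlt
  have hmem : e ∈ {e' ∈ F.filter fun e => w e ≠ 0 ∧ w e ≠ 1 | f e' = f e} := by
    simpa using he
  have huniq := card_le_one.1 (Nat.le_of_lt_succ hlt)
  obtain ⟨heF, h0, h1⟩ := mem_filter.1 he
  obtain ⟨z, hz⟩ := hf (f e)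
  rw [← add_sum_erase (F.filter fun e' => f e' = f e) w (mem_filter.2 ⟨heF, rfl⟩)] at hz
  have hrest : ∃ y : ℤ, ∑ e' ∈ (F.filter fun e' => f e' = f e).erase e, w e' = y := by
    refine ⟨∑ e' ∈ (F.filter fun e' => f e' = f e).erase e, if w e' = 0 then 0 else 1, ?_⟩
    push_cast
    refine sum_congr rfl fun e' he' => ?_
    obtain ⟨hne, he'⟩ := mem_erase.1 he'
    obtain ⟨he'F, hfe⟩ := mem_filter.1 he'
    by_cases h : w e' = 0
    · simp [h]
    · by_contra h'
      refine hne (huniq e' ?_ e hmem)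
      simp only [mem_filter]
      refine ⟨⟨he'F, h, fun h2 => h' ?_⟩, hfe⟩
      simp [h2]
  obtain ⟨y, hy⟩ := hrest
  rw [hy] at hz
  have hwe : w e = ((z - y : ℤ) : ℚ) := by push_cast; linarith
  obtain ⟨hl, hu⟩ := hw e heF
  rw [hwe] at hl hu h0 h1
  norm_cast at hl hu h0 h1
  omega

open Finset in
/-- Moving from the weighting `w` in the direction `x` until some weight becomes `0` or `1`. -/
theorem exists_step_to_boundary {E : Type*} (D : Finset E) (w x : E → ℚ)
    (hw : ∀ e ∈ D, 0 < w e ∧ w e < 1) (hx : ∃ e ∈ D, x e ≠ 0) :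
    ∃ t : ℚ, (∀ e ∈ D, 0 ≤ w e + t * x e ∧ w e + t * x e ≤ 1) ∧
      ∃ e ∈ D, w e + t * x e = 0 ∨ w e + t * x e = 1 := by
  let τ : E → ℚ := fun e => if 0 < x e then (1 - w e) / x e else w e / (-x e)
  obtain ⟨e₀, he₀, hx₀⟩ := hx
  obtain ⟨e₁, he₁, hmin⟩ := exists_min_image (D.filter fun e => x e ≠ 0) τ
    ⟨e₀, mem_filter.2 ⟨he₀, hx₀⟩⟩
  obtain ⟨he₁D, hx₁⟩ := mem_filter.1 he₁
  have hτ : 0 < τ e₁ := by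
    obtain ⟨h0, h1⟩ := hw e₁ he₁D
    by_cases h : 0 < x e₁
    · simp only [τ, h, if_true]
      exact div_pos (by linarith) h
    · simp only [τ, h, if_false]
      have : x e₁ < 0 := lt_of_le_of_ne (not_lt.1 h) hx₁
      exact div_pos h0 (by linarith)
  refine ⟨τ e₁, fun e he => ?_, e₁, he₁D, ?_⟩
  · obtain ⟨h0, h1⟩ := hw e he
    rcases lt_trichotomy (x e) 0 with h | h | h
    · have hm := hmin e (mem_filter.2 ⟨he, h.ne⟩)
      have hτe : τ e = w e / (-x e) := by simp [τ, not_lt.2 h.le]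
      rw [hτe, le_div_iff₀ (by linarith)] at hm
      constructor <;> nlinarith
    · rw [h]
      constructor <;> linarith
    · have hm := hmin e (mem_filter.2 ⟨he, h.ne'⟩)
      have hτe : τ e = (1 - w e) / x e := by simp [τ, h]
      rw [hτe, le_div_iff₀ h] at hm
      constructor <;> nlinarith
  · by_cases h : 0 < x e₁
    · right
      simp only [τ, h, if_true]
      field_simp
      ring
    · left
      simp only [τ, h, if_false]
      field_simp
      ring

open Finset in
/-- **Bipartite rounding.** A weighting with values in `[0, 1]` whose sums over the fibers of `f`
and of `g` are integers can be rounded to a subset having the same fiber sums. -/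
theorem exists_subset_card_fiber_eq_sum.{u, v} {E : Type u} {A B : Type v} [DecidableEq A]
    [DecidableEq B] (F : Finset E) (f : E → A) (g : E → B) (w : E → ℚ)
    (hw : ∀ e ∈ F, 0 ≤ w e ∧ w e ≤ 1) (hf : ∀ i, ∃ z : ℤ, ∑ e ∈ F with f e = i, w e = z)
    (hg : ∀ i, ∃ z : ℤ, ∑ e ∈ F with g e = i, w e = z) :
    ∃ G ⊆ F, (∀ i, (#{e ∈ G | f e = i} : ℚ) = ∑ e ∈ F with f e = i, w e) ∧
      ∀ i, (#{e ∈ G | g e = i} : ℚ) = ∑ e ∈ F with g e = i, w e := by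
  classical
  induction hN : #{e ∈ F | w e ≠ 0 ∧ w e ≠ 1} using Nat.strong_induction_on generalizing w with
  | _ N ih =>
    set D := F.filter fun e => w e ≠ 0 ∧ w e ≠ 1 with hDdef
    rcases D.eq_empty_or_nonempty with hD | hD
    · refine ⟨F.filter fun e => w e = 1, filter_subset _ _, ?_⟩
      have h01 : ∀ e ∈ F, w e = if w e = 1 then 1 else 0 := fun e he => by
        have := (filter_eq_empty_iff.1 hD) he
        by_cases h : w e = 1 <;> simp_all
      have key (p : E → Prop) [DecidablePred p] :
          (#{e ∈ F.filter fun e => w e = 1 | p e} : ℚ) = ∑ e ∈ F with p e, w e := by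
        rw [sum_congr rfl fun e he => h01 e (mem_filter.1 he).1, sum_boole, filter_comm]
      exact ⟨fun i => key _, fun i => key _⟩
    · obtain ⟨x, hx0, hxf, hxg⟩ := exists_ne_zero_fiber_sum_eq_zero D hD f g
        (two_le_card_fractional_fiber F f w hw hf) (two_le_card_fractional_fiber F g w hw hg)
      have hDw : ∀ e ∈ D, 0 < w e ∧ w e < 1 := fun e he => by
        obtain ⟨heF, h0, h1⟩ := mem_filter.1 he
        exact ⟨lt_of_le_of_ne (hw e heF).1 h0.symm, lt_of_le_of_ne (hw e heF).2 h1⟩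
      obtain ⟨t, ht, e₁, he₁, ht₁⟩ := exists_step_to_boundary D w x hDw hx0
      let w' : E → ℚ := fun e => w e + if e ∈ D then t * x e else 0
      have hsum {C : Type v} [DecidableEq C] (p : E → C)
          (hp : ∀ i, ∑ e ∈ D with p e = i, x e = 0) (i : C) :
          ∑ e ∈ F with p e = i, w' e = ∑ e ∈ F with p e = i, w e := by
        have : (F.filter fun e => p e = i).filter (fun e => e ∈ D) = D.filter fun e => p e = i := by
          ext e
          simp only [hDdef, mem_filter]
          tauto
        rw [sum_add_distrib, ← sum_filter, this, ← mul_sum, hp, mul_zero, add_zero]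
      have hw' : ∀ e ∈ F, 0 ≤ w' e ∧ w' e ≤ 1 := fun e he => by
        by_cases h : e ∈ D
        · simpa [w', h] using ht e h
        · simpa [w', h] using hw e he
      have hlt : #{e ∈ F | w' e ≠ 0 ∧ w' e ≠ 1} < N := by
        rw [← hN]
        refine card_lt_card (ssubset_iff_of_subset ?_ |>.2 ⟨e₁, he₁, ?_⟩)
        · intro e he
          by_contra h
          simp only [mem_filter, w', h, if_false, add_zero] at he
          exact h (mem_filter.2 he)
        · simp only [mem_filter, w', he₁, if_true]
          tauto
      obtain ⟨G, hGF, h1, h2⟩ := ih _ hlt w' hw' (fun i => by rw [hsum f hxf]; exact hf i)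
        (fun i => by rw [hsum g hxg]; exact hg i) rfl
      exact ⟨G, hGF, fun i => by rw [h1, hsum f hxf], fun i => by rw [h2, hsum g hxg]⟩

open Finset in
/-- **Equitable splitting.** If all fibers of `f` and of `g` have size divisible by `m + 1`, then
the ground set splits into `m + 1` classes, each meeting every fiber equally often. -/
theorem exists_equitable_splitting.{u, v} {E : Type u} {A B : Type v} [DecidableEq A] [DecidableEq B]
    (m : ℕ) (F : Finset E) (f : E → A) (g : E → B) (hf : ∀ i, m + 1 ∣ #{e ∈ F | f e = i})
    (hg : ∀ i, m + 1 ∣ #{e ∈ F | g e = i}) :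
    ∃ h : E → Fin (m + 1),
      (∀ x i, (m + 1) * #{e ∈ F | f e = i ∧ h e = x} = #{e ∈ F | f e = i}) ∧
      ∀ x i, (m + 1) * #{e ∈ F | g e = i ∧ h e = x} = #{e ∈ F | g e = i} := by
  classical
  induction m generalizing F with
  | zero => exact ⟨fun _ => 0, by simp, by simp⟩
  | succ m ih =>
    have hm : (0 : ℚ) < m + 2 := by positivity
    have hsum_int (p : E → Prop) [DecidablePred p] (hp : m + 1 + 1 ∣ #{e ∈ F | p e}) :
        ∃ z : ℤ, ∑ e ∈ F with p e, (1 / (m + 2) : ℚ) = z := by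
      obtain ⟨q, hq⟩ := hp
      refine ⟨q, ?_⟩
      rw [sum_const, hq, nsmul_eq_mul]
      push_cast
      field_simp
      ring
    obtain ⟨G, hGF, hGf, hGg⟩ := exists_subset_card_fiber_eq_sum F f g (fun _ => 1 / (m + 2))
      (fun e _ => ⟨by positivity, by rw [div_le_one hm]; linarith⟩)
      (fun i => hsum_int _ (hf i)) (fun i => hsum_int _ (hg i))
    have hcard (p : E → Prop) [DecidablePred p]
        (hp : (#{e ∈ G | p e} : ℚ) = ∑ e ∈ F with p e, (1 / (m + 2) : ℚ)) :
        (m + 1 + 1) * #{e ∈ G | p e} = #{e ∈ F | p e} ∧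
          #{e ∈ F \ G | p e} = (m + 1) * #{e ∈ G | p e} := by
      have h1 : (m + 1 + 1) * #{e ∈ G | p e} = #{e ∈ F | p e} := by
        rw [sum_const, nsmul_eq_mul] at hp
        field_simp at hp
        have : ((m : ℚ) + 1 + 1) * #{e ∈ G | p e} = #{e ∈ F | p e} := by linarith
        exact_mod_cast this
      have h2 : #{e ∈ F \ G | p e} + #{e ∈ G | p e} = #{e ∈ F | p e} := by
        rw [← card_union_of_disjoint (disjoint_filter_filter sdiff_disjoint), ← filter_union,
          sdiff_union_of_subset hGF]
      exact ⟨h1, by linarith⟩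
    obtain ⟨h, h1, h2⟩ := ih (F \ G) (fun i => ⟨_, (hcard _ (hGf i)).2⟩)
      (fun i => ⟨_, (hcard _ (hGg i)).2⟩)
    let h' : E → Fin (m + 1 + 1) := fun e => if e ∈ G then Fin.last _ else (h e).castSucc
    have final {C : Type v} [DecidableEq C] (p : E → C)
        (hp : ∀ i, (#{e ∈ G | p e = i} : ℚ) = ∑ e ∈ F with p e = i, (1 / (m + 2) : ℚ))
        (hi : ∀ x i, (m + 1) * #{e ∈ F \ G | p e = i ∧ h e = x} = #{e ∈ F \ G | p e = i})
        (x : Fin (m + 1 + 1)) (i : C) :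
        (m + 1 + 1) * #{e ∈ F | p e = i ∧ h' e = x} = #{e ∈ F | p e = i} := by
      obtain ⟨ha, hb⟩ := hcard _ (hp i)
      induction x using Fin.lastCases with
      | last =>
        rw [← ha]
        congr 2
        ext e
        have := @hGF e
        by_cases he : e ∈ G <;> simp [h', he, Fin.castSucc_ne_last]; tauto
      | cast x =>
        have hx : #{e ∈ F | p e = i ∧ h' e = x.castSucc} = #{e ∈ F \ G | p e = i ∧ h e = x} := by
          congr 1
          ext e
          by_cases he : e ∈ G <;> simp [h', he, (Fin.castSucc_ne_last _).symm]
        have := hi x i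
        rw [hb] at this
        rw [hx, ← ha, Nat.eq_of_mul_eq_mul_left (Nat.succ_pos m) this]
    exact ⟨h', final f hGf h1, final g hGg h2⟩

open Finset in
/-- `S` records, for each edge `e`, those vertices of `e` that lie in the first `l` parts; the
remaining parts are still amalgamated into a single vertex. -/
structure IsPartialDetachment {E : Type*} [Fintype E] {n m k : ℕ} (lam : ℕ) (r : Fin k → ℕ)
    (c : E → Fin k) (l : ℕ) (S : E → Finset (Fin n × Fin m)) : Prop where
  injOn : ∀ e, Set.InjOn Prod.fst (S e : Set (Fin n × Fin m))
  lt : ∀ e, ∀ a ∈ S e, a.1.val < l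
  card_le : ∀ e, #(S e) ≤ 3
  count : ∀ A : Finset (Fin n × Fin m), Set.InjOn Prod.fst (A : Set (Fin n × Fin m)) →
    (∀ a ∈ A, a.1.val < l) → ∀ p, #A + p = 3 →
      #{e | S e = A} = lam * (n - l).choose p * m ^ p
  degree : ∀ v : Fin n × Fin m, v.1.val < l → ∀ j, #{e | c e = j ∧ v ∈ S e} = r j

namespace IsPartialDetachment

open Finset

variable {E : Type*} [Fintype E] {n m k lam l : ℕ} {r : Fin k → ℕ} {c : E → Fin k}
  {S : E → Finset (Fin n × Fin m)}

theorem sum_card_color (hS : IsPartialDetachment lam r c l S) (hl : l ≤ n) (j : Fin k) :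
    ∑ e with c e = j, #(S e) = l * m * r j := by
  classical
  have h1 : ∑ e with c e = j, #(S e) =
      ∑ e with c e = j, #{v ∈ (univ : Finset (Fin n × Fin m)) | v ∈ S e} :=
    sum_congr rfl fun e _ => by simp
  have h2 := sum_card_bipartiteAbove_eq_sum_card_bipartiteBelow (fun e v => v ∈ S e)
    (s := univ.filter fun e => c e = j) (t := (univ : Finset (Fin n × Fin m)))
  simp only [bipartiteAbove, bipartiteBelow] at h2
  rw [h1, h2]
  have h3 : ∀ v : Fin n × Fin m,
      #{e ∈ univ.filter fun e => c e = j | v ∈ S e} = if v.1.val < l then r j else 0 := by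
    intro v
    rw [filter_filter]
    split_ifs with hv
    · exact hS.degree v hv j
    · rw [card_eq_zero, filter_eq_empty_iff]
      exact fun e _ h => hv (hS.lt e v h.2)
  have h4 : #{i : Fin n | i.val < l} = l := by simp [Fin.card_filter_val_lt, hl]
  have h5 (u : Fin n → ℕ) : ∑ v : Fin n × Fin m, u v.1 = m * ∑ i, u i := by
    simp [Fintype.sum_prod_type, mul_sum]
  rw [sum_congr rfl fun v _ => h3 v, h5 fun i => if i.val < l then r j else 0, ← sum_filter,
    sum_const, h4, smul_eq_mul]
  ring

/-- The edges that will receive a vertex of part `l`. -/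
theorem exists_next_part (hS : IsPartialDetachment lam r c l S) (hl : l < n)
    (hc : ∀ j, 3 * #{e | c e = j} = n * m * r j) :
    ∃ G : Finset E, (∀ j, #{e ∈ G | c e = j} = m * r j) ∧ (∀ e ∈ G, #(S e) ≤ 2) ∧
      ∀ A : Finset (Fin n × Fin m), Set.InjOn Prod.fst (A : Set (Fin n × Fin m)) →
        (∀ a ∈ A, a.1.val < l) → ∀ p, #A + p = 2 →
          #{e ∈ G | S e = A} = lam * (n - (l + 1)).choose p * m ^ (p + 1) := by
  obtain ⟨N, hN⟩ : ∃ N, n - l = N + 1 := ⟨n - l - 1, by omega⟩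
  have hN' : n - (l + 1) = N := by omega
  have hNpos : (0 : ℚ) < N + 1 := by positivity
  let w : E → ℚ := fun e => (3 - #(S e)) / (N + 1)
  have hfiber (A) : ∑ e with S e = A, w e = #{e | S e = A} * (3 - #A) / (N + 1) := by
    rw [sum_congr rfl fun e he => show w e = (3 - #A) / (N + 1) by
      simp only [w, (mem_filter.1 he).2], sum_const, nsmul_eq_mul, mul_div_assoc]
  have hfiber2 (A : Finset (Fin n × Fin m)) (hA : Set.InjOn Prod.fst (A : Set (Fin n × Fin m)))
      (hAl : ∀ a ∈ A, a.1.val < l) (p : ℕ) (hp : #A + p = 2) :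
      ∑ e with S e = A, w e = ((lam * N.choose p * m ^ (p + 1) : ℕ) : ℚ) := by
    have hA2 : (#A : ℚ) + p = 2 := by exact_mod_cast hp
    have hch : ((N : ℚ) + 1) * N.choose p = (N + 1).choose (p + 1) * (p + 1) := by
      exact_mod_cast Nat.add_one_mul_choose_eq N p
    rw [hfiber, hS.count A hA hAl (p + 1) (by omega), hN, div_eq_iff hNpos.ne',
      show (3 : ℚ) - #A = p + 1 by linarith]
    push_cast
    linear_combination (-(lam : ℚ) * m ^ (p + 1)) * hch
  have hcolor (j) : ∑ e with c e = j, w e = ((m * r j : ℕ) : ℚ) := by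
    have h1 : (3 : ℚ) * #{e | c e = j} = n * m * r j := by exact_mod_cast hc j
    have h2 : ∑ e with c e = j, (#(S e) : ℚ) = l * m * r j := by
      exact_mod_cast hS.sum_card_color hl.le j
    have h3 : (n : ℚ) = l + N + 1 := by
      have : n = l + N + 1 := by omega
      exact_mod_cast this
    simp only [w]
    rw [← sum_div, sum_sub_distrib, h2, sum_const, nsmul_eq_mul, mul_comm _ (3 : ℚ), h1,
      div_eq_iff hNpos.ne', h3]
    push_cast
    ring
  have hw : ∀ e ∈ univ, 0 ≤ w e ∧ w e ≤ 1 := by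
    intro e _
    obtain ⟨p, hp⟩ := Nat.exists_eq_add_of_le (hS.card_le e)
    have hpos : 0 < #{e' | S e' = S e} := card_pos.2 ⟨e, by simp⟩
    rw [hS.count (S e) (hS.injOn e) (hS.lt e) p hp.symm, hN] at hpos
    have hle : p ≤ N + 1 := by
      by_contra! h
      simp [Nat.choose_eq_zero_of_lt h] at hpos
    have hp' : (3 : ℚ) - #(S e) = p := by
      have : (3 : ℚ) = #(S e) + p := by exact_mod_cast hp
      linarith
    have hle' : (p : ℚ) ≤ N + 1 := by exact_mod_cast hle
    simp only [w, hp']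
    exact ⟨by positivity, by rwa [div_le_one hNpos]⟩
  obtain ⟨G, -, hGc, hGS⟩ := exists_subset_card_fiber_eq_sum univ c S w hw
    (fun j => ⟨(m * r j : ℕ), by rw [hcolor]; norm_cast⟩) fun A => by
      by_cases hA : ∃ e, S e = A
      · obtain ⟨e, rfl⟩ := hA
        by_cases h3 : #(S e) = 3
        · exact ⟨0, by rw [hfiber, h3]; norm_num⟩
        · have := hS.card_le e
          refine ⟨_, (hfiber2 _ (hS.injOn e) (hS.lt e) (2 - #(S e)) (by omega)).trans
            (Int.cast_natCast _).symm⟩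
      · refine ⟨0, ?_⟩
        rw [hfiber, filter_false_of_mem fun e _ h => hA ⟨e, h⟩]
        simp
  refine ⟨G, fun j => by exact_mod_cast (hGc j).trans (hcolor j), fun e he => ?_,
    fun A hA hAl p hp => by rw [hN']; exact_mod_cast (hGS A).trans (hfiber2 A hA hAl p hp)⟩
  by_contra! h
  have h3 : #(S e) = 3 := le_antisymm (hS.card_le e) h
  have h0 := hGS (S e)
  rw [hfiber, h3] at h0
  have h1 : #{e' ∈ G | S e' = S e} = 0 := by
    have : (#{e' ∈ G | S e' = S e} : ℚ) = 0 := by rw [h0]; norm_num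
    exact_mod_cast this
  rw [card_eq_zero, filter_eq_empty_iff] at h1
  exact h1 he rfl

theorem exists_succ (hS : IsPartialDetachment lam r c l S) (hm : 1 ≤ m) (hl : l < n)
    (hc : ∀ j, 3 * #{e | c e = j} = n * m * r j) :
    ∃ S' : E → Finset (Fin n × Fin m), IsPartialDetachment lam r c (l + 1) S' := by
  classical
  obtain ⟨m, rfl⟩ : ∃ m', m = m' + 1 := ⟨m - 1, by omega⟩
  obtain ⟨G, hGc, hG2, hGS⟩ := hS.exists_next_part hl hc
  obtain ⟨h, hhc, hhS⟩ := exists_equitable_splitting m G c S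
    (fun j => ⟨_, hGc j⟩) fun A => by
      by_cases hA : ∃ e ∈ G, S e = A
      · obtain ⟨e, he, rfl⟩ := hA
        have := hG2 e he
        rw [hGS _ (hS.injOn e) (hS.lt e) (2 - #(S e)) (by omega), pow_succ, ← mul_assoc]
        exact dvd_mul_left _ _
      · rw [filter_false_of_mem fun e he h => hA ⟨e, he, h⟩]
        simp
  let i : Fin n := ⟨l, hl⟩
  have hi (e : E) (x : Fin (m + 1)) : (i, x) ∉ S e := fun hx => (hS.lt e _ hx).ne rfl
  let S' : E → Finset (Fin n × Fin (m + 1)) := fun e =>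
    if e ∈ G then insert (i, h e) (S e) else S e
  have hS'G {e} (he : e ∈ G) : S' e = insert (i, h e) (S e) := if_pos he
  have hS'n {e} (he : e ∉ G) : S' e = S e := if_neg he
  have hmem (e : E) (x : Fin (m + 1)) : (i, x) ∈ S' e ↔ e ∈ G ∧ h e = x := by
    by_cases he : e ∈ G
    · simp [hS'G he, hi, he, eq_comm]
    · simp [hS'n he, hi, he]
  have hmem' (e : E) (v : Fin n × Fin (m + 1)) (hv : v.1.val < l) : v ∈ S' e ↔ v ∈ S e := by
    have hvi : v ≠ (i, h e) := by
      rintro rfl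
      exact hv.ne rfl
    by_cases he : e ∈ G
    · simp [hS'G he, hvi]
    · simp [hS'n he]
  refine ⟨S', fun e => ?_, fun e a ha => ?_, fun e => ?_, fun A hA hAl p hp => ?_,
    fun v hv j => ?_⟩
  · by_cases he : e ∈ G
    · rw [hS'G he, coe_insert, Set.injOn_insert (hi e _)]
      refine ⟨hS.injOn e, ?_⟩
      rintro ⟨a, ha, hai⟩
      have := hS.lt e a ha
      rw [hai] at this
      exact this.ne rfl
    · rw [hS'n he]
      exact hS.injOn e
  · by_cases he : e ∈ G
    · rw [hS'G he, mem_insert] at ha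
      rcases ha with rfl | ha
      · exact Nat.lt_succ_self l
      · exact (hS.lt e a ha).trans (Nat.lt_succ_self l)
    · rw [hS'n he] at ha
      exact (hS.lt e a ha).trans (Nat.lt_succ_self l)
  · by_cases he : e ∈ G
    · rw [hS'G he, card_insert_of_notMem (hi e _)]
      have := hG2 e he
      omega
    · rw [hS'n he]
      exact hS.card_le e
  · by_cases hx : ∃ x, (i, x) ∈ A
    · obtain ⟨x, hx⟩ := hx
      have hAe : ∀ a ∈ A.erase (i, x), a.1.val < l := by
        intro a ha
        obtain ⟨hne, haA⟩ := mem_erase.1 ha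
        refine lt_of_le_of_ne (Nat.lt_succ_iff.1 (hAl a haA)) fun h => ?_
        exact hne (hA haA hx (Fin.ext h))
      have hset : #{e | S' e = A} = #{e ∈ G | S e = A.erase (i, x) ∧ h e = x} := by
        congr 1
        ext e
        simp only [mem_filter, mem_univ, true_and]
        constructor
        · rintro rfl
          obtain ⟨he, rfl⟩ := (hmem e x).1 hx
          exact ⟨he, by rw [hS'G he, erase_insert (hi e _)], rfl⟩
        · rintro ⟨he, hSe, rfl⟩
          rw [hS'G he, hSe, insert_erase hx]
      have hcard := card_erase_add_one hx
      have hmul := hhS x (A.erase (i, x))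
      rw [hGS _ (hA.mono (by simp)) hAe p (by omega)] at hmul
      rw [hset]
      apply Nat.eq_of_mul_eq_mul_left (show 0 < m + 1 by omega)
      rw [hmul]
      ring
    · have hAl' : ∀ a ∈ A, a.1.val < l := by
        intro a ha
        refine lt_of_le_of_ne (Nat.lt_succ_iff.1 (hAl a ha)) fun h => hx ⟨a.2, ?_⟩
        rwa [show i = a.1 from Fin.ext h.symm]
      have hset : #{e | S' e = A} + #{e ∈ G | S e = A} = #{e | S e = A} := by
        rw [← card_union_of_disjoint]
        · congr 1
          ext e
          simp only [mem_union, mem_filter, mem_univ, true_and]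
          by_cases he : e ∈ G
          · have : S' e ≠ A := by
              rintro rfl
              exact hx ⟨h e, (hmem e _).2 ⟨he, rfl⟩⟩
            simp [he, this]
          · simp [he, hS'n he]
        · rw [disjoint_left]
          intro e he1 he2
          simp only [mem_filter, mem_univ, true_and] at he1 he2
          exact hx ⟨h e, he1 ▸ (hmem e _).2 ⟨he2.1, rfl⟩⟩
      rw [hS.count A hA hAl' p hp, show n - l = n - (l + 1) + 1 by omega] at hset
      cases p with
      | zero =>
        have : #{e ∈ G | S e = A} = 0 := by
          rw [card_eq_zero, filter_eq_empty_iff]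
          rintro e he rfl
          have := hG2 e he
          omega
        simpa [this] using hset
      | succ p =>
        rw [hGS A hA hAl' p (by omega), Nat.choose_succ_succ] at hset
        linarith
  · rcases Nat.lt_succ_iff_lt_or_eq.1 hv with hv | hv
    · simp only [hmem' _ v hv]
      exact hS.degree v hv j
    · obtain ⟨a, x⟩ := v
      obtain rfl : a = i := Fin.ext hv
      have hset : #{e | c e = j ∧ (i, x) ∈ S' e} = #{e ∈ G | c e = j ∧ h e = x} := by
        congr 1
        ext e
        simp only [mem_filter, mem_univ, true_and, hmem]
        tauto
      have hmul := hhc x j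
      rw [hGc] at hmul
      rw [hset]
      exact Nat.eq_of_mul_eq_mul_left (Nat.succ_pos m) hmul

theorem exists_of_card (r : Fin k → ℕ) (c : E → Fin k) (hm : 1 ≤ m)
    (hc : ∀ j, 3 * #{e | c e = j} = n * m * r j)
    (hE : Fintype.card E = lam * n.choose 3 * m ^ 3) (hl : l ≤ n) :
    ∃ S : E → Finset (Fin n × Fin m), IsPartialDetachment lam r c l S := by
  induction l with
  | zero =>
    refine ⟨fun _ => ∅, by simp, by simp, by simp, fun A _ hA p hp => ?_, by simp⟩
    obtain rfl : A = ∅ := eq_empty_of_forall_notMem fun a ha => absurd (hA a ha) (by simp)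
    obtain rfl : p = 3 := by simpa using hp
    simpa using hE
  | succ l ih =>
    obtain ⟨S, hS⟩ := ih (by omega)
    exact hS.exists_succ hm hl hc

end IsPartialDetachment

open Finset in
/-- Reading a coloring of the edges of `λK³_{m,…,m}` off a complete detachment. -/
theorem IsPartialDetachment.exists_coloring {E : Type*} [Fintype E] {n m k lam : ℕ}
    {r : Fin k → ℕ} {c : E → Fin k} {S : E → Finset (Fin n × Fin m)}
    (hS : IsPartialDetachment lam r c n S) :
    ∃ c' : {T : Finset (Fin n × Fin m) //
            T.card = 3 ∧ ∀ a ∈ T, ∀ b ∈ T, a.1 = b.1 → a = b} → Fin lam → Fin k,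
      ∀ v : Fin n × Fin m, ∀ j : Fin k,
        (Finset.univ.filter
          fun p : {T : Finset (Fin n × Fin m) //
              T.card = 3 ∧ ∀ a ∈ T, ∀ b ∈ T, a.1 = b.1 → a = b} × Fin lam =>
            v ∈ p.1.val ∧ c' p.1 p.2 = j).card = r j := by
  classical
  have hcard (e : E) : #(S e) = 3 := by
    obtain ⟨p, hp⟩ := Nat.exists_eq_add_of_le (hS.card_le e)
    have hpos : 0 < #{e' | S e' = S e} := card_pos.2 ⟨e, by simp⟩
    rw [hS.count (S e) (hS.injOn e) (hS.lt e) p hp.symm, Nat.sub_self] at hpos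
    cases p with
    | zero => exact hp.symm
    | succ p => simp at hpos
  let T : E → {T : Finset (Fin n × Fin m) //
      T.card = 3 ∧ ∀ a ∈ T, ∀ b ∈ T, a.1 = b.1 → a = b} := fun e =>
    ⟨S e, hcard e, fun a ha b hb => hS.injOn e ha hb⟩
  have hT (t) : Fintype.card {e // T e = t} = Fintype.card (Fin lam) := by
    have := hS.count t.1 (fun a ha b hb => t.2.2 a ha b hb) (fun a _ => a.1.2) 0 (by simp [t.2.1])
    rw [Fintype.card_subtype, Fintype.card_fin]
    simpa [T, Subtype.ext_iff] using this
  let φ t : {e // T e = t} ≃ Fin lam := Fintype.equivOfCardEq (hT t)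
  refine ⟨fun t x => c ((φ t).symm x), fun v j => ?_⟩
  rw [← hS.degree v v.1.2 j]
  let Θ := (Equiv.sigmaEquivProd _ _).symm.trans
    ((Equiv.sigmaCongrRight fun t => (φ t).symm).trans (Equiv.sigmaFiberEquiv T))
  refine card_equiv Θ fun p => ?_
  have hΘ : Θ p = (φ p.1).symm p.2 := rfl
  have hS' : S ((φ p.1).symm p.2) = p.1.1 := congrArg Subtype.val ((φ p.1).symm p.2).2
  simp only [mem_filter, mem_univ, true_and, hΘ, hS']
  exact and_comm

/-- **Sufficiency for `(r₁,…,r_k)`-factorization of `λK³_{m,…,m}` (n parts).**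
If `n ≥ 3`, `3 ∣ rᵢ·m·n` for each `i`, and `∑ rᵢ = λ·C(n-1,2)·m²`, then the
complete 3-uniform `n`-partite multi-hypergraph `λK³_{m,…,m}`, with vertex
set `Fin n × Fin m` (part `i` being `{i} × Fin m`), is
`(r₁,…,r_k)`-factorizable: there is a coloring `c` of its edges (pairs
`(T, l)` where `T` is a 3-element subset of `Fin n × Fin m` whose elements
have pairwise distinct first coordinates and `l ∈ Fin λ`) by colors in
`Fin k` such that every vertex is incident with exactly `r j` edges of each
color `j`. -/
theorem lambdaKmmm3_factorizable (n m lam k : ℕ) (hn : 3 ≤ n) (hm : 1 ≤ m)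
    (hlam : 1 ≤ lam) (hk : 1 ≤ k) (r : Fin k → ℕ) (hr : ∀ i, 0 < r i)
    (hdiv : ∀ i : Fin k, 3 ∣ r i * m * n)
    (hsum : ∑ i, r i = lam * Nat.choose (n - 1) 2 * m ^ 2) :
    ∃ c : {T : Finset (Fin n × Fin m) //
            T.card = 3 ∧ ∀ a ∈ T, ∀ b ∈ T, a.1 = b.1 → a = b} → Fin lam → Fin k,
      ∀ v : Fin n × Fin m, ∀ j : Fin k,
        (Finset.univ.filter
          fun p : {T : Finset (Fin n × Fin m) //
              T.card = 3 ∧ ∀ a ∈ T, ∀ b ∈ T, a.1 = b.1 → a = b} × Fin lam =>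
            v ∈ p.1.val ∧ c p.1 p.2 = j).card = r j := by
  classical
  let E := Σ j : Fin k, Fin (r j * m * n / 3)
  have hc (j : Fin k) :
      3 * (Finset.univ.filter fun e : E => e.1 = j).card = n * m * r j := by
    have h1 : (Finset.univ.filter fun e : E => e.1 = j).card = r j * m * n / 3 := by
      rw [← Fintype.card_subtype, Fintype.card_congr (Equiv.sigmaSubtype j)]
      simp
    rw [h1, Nat.mul_div_cancel' (hdiv j)]
    ring
  have hE : Fintype.card E = lam * n.choose 3 * m ^ 3 := by
    obtain ⟨N, rfl⟩ : ∃ N, n = N + 1 := ⟨n - 1, by omega⟩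
    have h1 : 3 * Fintype.card E = (∑ j, r j) * m * (N + 1) := by
      rw [Fintype.card_sigma, Finset.mul_sum, Finset.sum_mul, Finset.sum_mul]
      refine Finset.sum_congr rfl fun j _ => ?_
      rw [Fintype.card_fin, Nat.mul_div_cancel' (hdiv j)]
    have h2 := Nat.add_one_mul_choose_eq N 2
    rw [hsum, Nat.add_sub_cancel] at h1
    apply Nat.eq_of_mul_eq_mul_left (show 0 < 3 by norm_num)
    rw [h1]
    linear_combination lam * m ^ 3 * h2
  obtain ⟨S, hS⟩ := IsPartialDetachment.exists_of_card r (Sigma.fst : E → Fin k) hm hc hE le_rfl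
  exact hS.exists_coloring
end
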